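/- arXiv:2605.29457 — 7 statements merged into one kernel-verified Lean document; each statement's English description precedes it below -/
import Mathlib

section
/- Let G be a finite group of order n and let x be an element of G. Then the number of elements y ∈ G with y² = x is at most √(n · cl(G)). -/
open scoped Classical

noncomputable section

/-- An element `z` inverting `a` when one exists, and `1` otherwise. -/
def inverter {G : Type*} [Group G] (a : G) : G :=
  if h : ∃ z : G, z * a * z⁻¹ = a⁻¹ then h.choose else 1

lemma commute_inverter_inv_mul {G : Type*} [Group G] {a z : G} (h : z * a * z⁻¹ = a⁻¹) :
    Commute a ((inverter a)⁻¹ * z) := by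
  have hex : ∃ z : G, z * a * z⁻¹ = a⁻¹ := ⟨z, h⟩
  have hw : inverter a * a * (inverter a)⁻¹ = a⁻¹ := by
    rw [inverter, dif_pos hex]
    exact hex.choose_spec
  rw [mul_inv_eq_iff_eq_mul] at h hw
  rw [commute_iff_eq, mul_assoc, h, eq_inv_mul_iff_mul_eq, ← mul_assoc, ← mul_assoc, hw]
  group

lemma conj_mul_inv_of_mul_self_eq {G : Type*} [Group G] {y z : G} (h : y * y = z * z) :
    z * (y * z⁻¹) * z⁻¹ = (y * z⁻¹)⁻¹ := by
  rw [eq_inv_iff_mul_eq_one]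
  calc z * (y * z⁻¹) * z⁻¹ * (y * z⁻¹) = z * y * (z * z)⁻¹ * y * z⁻¹ := by group
    _ = 1 := by rw [← h]; group

/-- The pairs of square roots of `x` inject into the commuting pairs. -/
lemma card_sq_roots_sq_le {G : Type*} [Group G] [Fintype G] [DecidableEq G] (x : G) :
    (Finset.univ.filter fun y : G => y * y = x).card ^ 2 ≤
      Nat.card (ConjClasses G) * Nat.card G := by
  set S := Finset.univ.filter fun y : G => y * y = x with hS
  have hmem {y : G} (hy : y ∈ S) : y * y = x := by simpa [hS] using hy
  let f : S × S → {p : G × G // Commute p.1 p.2} := fun p =>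
    ⟨(p.1 * (p.2 : G)⁻¹, (inverter (p.1 * (p.2 : G)⁻¹))⁻¹ * p.2),
      commute_inverter_inv_mul <| conj_mul_inv_of_mul_self_eq <|
        (hmem p.1.2).trans (hmem p.2.2).symm⟩
  have hf : Function.Injective f := by
    rintro ⟨⟨y, hy⟩, ⟨z, hz⟩⟩ ⟨⟨y', hy'⟩, ⟨z', hz'⟩⟩ h
    obtain ⟨h₁, h₂⟩ := Prod.ext_iff.mp (Subtype.ext_iff.mp h)
    simp only [f] at h₁ h₂
    rw [h₁, mul_right_inj] at h₂
    subst h₂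
    simpa using h₁
  rw [← card_comm_eq_card_conjClasses_mul_card]
  simpa [sq] using Nat.card_le_card_of_injective f hf

theorem stmt7 (G : Type*) [Group G] [Fintype G] [DecidableEq G] (x : G) :
    ((Finset.univ.filter fun y : G => y * y = x).card : ℝ) ≤
      Real.sqrt ((Fintype.card G : ℝ) * (Nat.card (ConjClasses G) : ℝ)) := by
  apply Real.le_sqrt_of_sq_le
  rw [mul_comm, ← Nat.card_eq_fintype_card]
  exact_mod_cast card_sq_roots_sq_le x
end
end

section
/- Fix γ ∈ (0,1) and let d_N = (1−γ)·√(log N/(2·log log N)). For every ε > 0 there exists N₀ such that for every finite group G of order N ≥ N₀, every integer d with 2 ≤ d ≤ d_N, and every x ∈ G∖{1}, the number of edges of size d of the diameter-d hypergraph Γ_x satisfies e_d(x) ≥ (1−ε)·N^(d−1)/d!. -/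
open scoped Classical

noncomputable section

/-- `E` is an edge of the diameter-`d` hypergraph `Γ_x`: `E ⊆ G∖{1}` and there exist
`ℓ` with `|E| ≤ ℓ ≤ d`, elements `h₁,…,h_ℓ ∈ E` covering `E`, and signs
`a₁,…,a_ℓ ∈ {−1,1}` with `h₁^{a₁}⋯h_ℓ^{a_ℓ} = x`. -/
def IsEdge {G : Type*} [Group G] (d : ℕ) (x : G) (E : Finset G) : Prop :=
  (1 : G) ∉ E ∧ ∃ ℓ : ℕ, E.card ≤ ℓ ∧ ℓ ≤ d ∧
    ∃ h : Fin ℓ → G, ∃ a : Fin ℓ → ℤ,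
      (∀ i, h i ∈ E) ∧ (∀ g ∈ E, ∃ i, h i = g) ∧
      (∀ i, a i = 1 ∨ a i = -1) ∧
      (List.ofFn fun i => h i ^ a i).prod = x

/-- `e_k(x)`: the number of `k`-edges of the diameter-`d` hypergraph `Γ_x`. -/
def edgeCount {G : Type*} [Group G] [Fintype G] (d k : ℕ) (x : G) : ℕ :=
  (Finset.univ.filter fun E : Finset G => E.card = k ∧ IsEdge d x E).card

/-- `d_N = (1-γ)·√(log N / (2 log log N))`. -/
def dN (γ : ℝ) (N : ℕ) : ℝ :=
  (1 - γ) * Real.sqrt (Real.log N / (2 * Real.log (Real.log N)))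

/-- The product of the entries of `l`, in order and with suitable signs, is `x`. -/
def HasSignedProd {G : Type*} [Group G] (l : List G) (x : G) : Prop :=
  ∃ a : Fin l.length → ℤ, (∀ i, a i = 1 ∨ a i = -1) ∧
    (List.ofFn fun i => l.get i ^ a i).prod = x

theorem HasSignedProd.cons {G : Type*} [Group G] {l : List G} {g x : G}
    (h : HasSignedProd l (g⁻¹ * x)) : HasSignedProd (g :: l) x := by
  obtain ⟨a, ha, hx⟩ := h
  refine ⟨Fin.cons 1 a, fun i => ?_, ?_⟩
  · refine Fin.cases ?_ (fun j => ?_) i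
    · exact Or.inl rfl
    · exact ha j
  · have : (List.ofFn fun i => (g :: l).get i ^ (Fin.cons 1 a : Fin (l.length + 1) → ℤ) i) =
        g :: List.ofFn fun i => l.get i ^ a i := by
      refine (List.ofFn_succ (n := l.length)).trans ?_
      simp
    rw [this, List.prod_cons, hx, mul_inv_cancel_left]

theorem hasSignedProd_pair {G : Type*} [Group G] (x b : G) : HasSignedProd [x * b, b] x :=
  ⟨![1, -1], fun i => by fin_cases i <;> simp, by simp⟩

/-- Choosing the entries greedily, there are many lists of distinct elements outside `S` with
a signed product equal to `x`. -/
theorem exists_many_lists {G : Type*} [Group G] [Fintype G] (c n : ℕ) (S : Finset G) (x : G)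
    (hx : x ≠ 1) (hc : 2 * (S.card + n) ≤ c) :
    ∃ A : Finset (List G), (Fintype.card G - c) ^ (n + 1) ≤ A.card ∧
      ∀ l ∈ A, l.length = n + 2 ∧ l.Nodup ∧ (∀ g ∈ l, g ∉ S) ∧ HasSignedProd l x := by
  induction n generalizing S x with
  | zero =>
    refine ⟨(S ∪ S.image (x⁻¹ * ·))ᶜ.image fun b => [x * b, b], ?_, ?_⟩
    · rw [Finset.card_image_of_injective _ (fun b b' h => by simpa using h), Finset.card_compl]
      have h1 := Finset.card_union_le S (S.image (x⁻¹ * ·))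
      have h2 : (S.image (x⁻¹ * ·)).card ≤ S.card := Finset.card_image_le
      simp only [zero_add, pow_one]
      omega
    · intro l hl
      obtain ⟨b, hb, rfl⟩ := Finset.mem_image.1 hl
      simp only [Finset.mem_compl, Finset.mem_union, Finset.mem_image, not_or, not_exists,
        not_and] at hb
      refine ⟨rfl, by simpa using hx, ?_, hasSignedProd_pair x b⟩
      simp only [List.mem_cons, List.not_mem_nil, or_false, forall_eq_or_imp, forall_eq]
      exact ⟨fun h => hb.2 _ h (by simp), hb.1⟩
  | succ n ih =>
    have key : ∀ g : G, ∃ A : Finset (List G), g ∈ (insert x S)ᶜ →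
        (Fintype.card G - c) ^ (n + 1) ≤ A.card ∧ ∀ l ∈ A, l.length = n + 2 ∧ l.Nodup ∧
          (∀ k ∈ l, k ∉ insert g S) ∧ HasSignedProd l (g⁻¹ * x) := by
      intro g
      by_cases hg : g ∈ (insert x S)ᶜ
      · have hgx : g ≠ x := fun h => by simp [h] at hg
        obtain ⟨A, hA⟩ := ih (insert g S) (g⁻¹ * x)
          (fun h => hgx (inv_mul_eq_one.1 h))
          (by have := Finset.card_insert_le g S; omega)
        exact ⟨A, fun _ => hA⟩
      · exact ⟨∅, fun h => absurd h hg⟩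
    choose A hA using key
    refine ⟨(insert x S)ᶜ.biUnion fun g => (A g).image (List.cons g), ?_, ?_⟩
    · rw [Finset.card_biUnion]
      · calc (Fintype.card G - c) ^ (n + 1 + 1)
            ≤ (insert x S)ᶜ.card * (Fintype.card G - c) ^ (n + 1) := by
              rw [pow_succ']
              refine Nat.mul_le_mul_right _ ?_
              rw [Finset.card_compl]
              have := Finset.card_insert_le x S
              omega
          _ = ∑ g ∈ (insert x S)ᶜ, (Fintype.card G - c) ^ (n + 1) := by simp
          _ ≤ _ := Finset.sum_le_sum fun g hg => by
              rw [Finset.card_image_of_injective _ List.cons_injective]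
              exact (hA g hg).1
      · intro g _ g' _ hne
        refine Finset.disjoint_left.2 ?_
        intro l hl hl'
        obtain ⟨_, _, rfl⟩ := Finset.mem_image.1 hl
        obtain ⟨_, _, h⟩ := Finset.mem_image.1 hl'
        exact hne (List.cons.inj h).1.symm
    · intro l hl
      obtain ⟨g, hg, hl⟩ := Finset.mem_biUnion.1 hl
      obtain ⟨t, ht, rfl⟩ := Finset.mem_image.1 hl
      obtain ⟨h1, h2, h3, h4⟩ := (hA g hg).2 t ht
      refine ⟨by simp [h1], List.nodup_cons.2 ⟨fun h => h3 g h (Finset.mem_insert_self _ _), h2⟩,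
        ?_, h4.cons⟩
      intro k hk
      rcases List.mem_cons.1 hk with rfl | hk
      · exact fun h => (Finset.mem_compl.1 hg) (Finset.mem_insert_of_mem h)
      · exact fun h => h3 k hk (Finset.mem_insert_of_mem h)

theorem isEdge_toFinset {G : Type*} [Group G] {l : List G} {x : G} (hl : l.Nodup)
    (h1 : 1 ∉ l) (hx : HasSignedProd l x) : IsEdge l.length x l.toFinset := by
  obtain ⟨a, ha, hax⟩ := hx
  refine ⟨by simpa using h1, l.length, (List.toFinset_card_of_nodup hl).le, le_rfl, l.get, a,
    fun i => by simp, fun g hg => ?_, ha, hax⟩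
  exact List.mem_iff_get.1 (List.mem_toFinset.1 hg)

/-- At most `d!` duplicate-free lists of length `d` have a given set of entries. -/
theorem card_filter_toFinset_le {α : Type*} (A : Finset (List α)) (d : ℕ)
    (hA : ∀ l ∈ A, l.length = d ∧ l.Nodup) (E : Finset α) :
    (A.filter fun l => l.toFinset = E).card ≤ d.factorial := by
  rcases (A.filter fun l => l.toFinset = E).eq_empty_or_nonempty with h | ⟨m, hm⟩
  · simp [h]
  · obtain ⟨hm, hmE⟩ := Finset.mem_filter.1 hm
    have hsub : (A.filter fun l => l.toFinset = E) ⊆ m.permutations.toFinset := by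
      intro l hl
      obtain ⟨hl, hlE⟩ := Finset.mem_filter.1 hl
      rw [List.mem_toFinset, List.mem_permutations]
      exact List.perm_of_nodup_nodup_toFinset_eq (hA l hl).2 (hA m hm).2 (hlE.trans hmE.symm)
    calc _ ≤ m.permutations.toFinset.card := Finset.card_le_card hsub
      _ ≤ m.permutations.length := List.toFinset_card_le _
      _ = d.factorial := by rw [List.length_permutations, (hA m hm).1]

theorem pow_le_factorial_mul_edgeCount {G : Type*} [Group G] [Fintype G] {d : ℕ} (hd : 2 ≤ d)
    {x : G} (hx : x ≠ 1) :
    (Fintype.card G - 2 * d) ^ (d - 1) ≤ d.factorial * edgeCount d d x := by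
  obtain ⟨A, hcard, hA⟩ := exists_many_lists (2 * d) (d - 2) {(1 : G)} x hx
    (by rw [Finset.card_singleton]; omega)
  rw [show d - 2 + 1 = d - 1 by omega] at hcard
  rw [show d - 2 + 2 = d by omega] at hA
  refine hcard.trans ?_
  refine Finset.card_le_mul_card_image_of_maps_to (f := List.toFinset) (fun l hl => ?_) _
    (fun E _ => card_filter_toFinset_le A d (fun l hl => ⟨(hA l hl).1, (hA l hl).2.1⟩) E)
  obtain ⟨h1, h2, h3, h4⟩ := hA l hl
  refine Finset.mem_filter.2 ⟨Finset.mem_univ _, by rw [List.toFinset_card_of_nodup h2, h1], ?_⟩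
  have := isEdge_toFinset h2 (fun h => h3 1 h (Finset.mem_singleton_self _)) h4
  rwa [h1] at this

theorem sq_le_log_of_le_dN {γ : ℝ} (hγ0 : 0 < γ) (hγ1 : γ < 1) {N d : ℕ}
    (hN : 1 ≤ Real.log (Real.log N)) (hd : (d : ℝ) ≤ dN γ N) :
    (d : ℝ) ^ 2 ≤ Real.log N := by
  have hq : 0 ≤ Real.log N / (2 * Real.log (Real.log N)) := by positivity
  calc (d : ℝ) ^ 2 ≤ (dN γ N) ^ 2 := by gcongr
    _ = (1 - γ) ^ 2 * (Real.log N / (2 * Real.log (Real.log N))) := by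
        rw [dN, mul_pow, Real.sq_sqrt hq]
    _ ≤ 1 * (Real.log N / 1) := by
        gcongr
        · nlinarith
        · linarith
    _ = Real.log N := by ring

theorem one_sub_mul_pow_le {N ε : ℝ} {d n : ℕ} (hN : 0 < N) (h2 : 2 * (d : ℝ) ≤ N)
    (h : n * (2 * (d : ℝ)) ≤ ε * N) : (1 - ε) * N ^ n ≤ (N - 2 * d) ^ n := by
  have ha : 2 * (d : ℝ) / N ≤ 1 := (div_le_one hN).2 h2
  have hε : n * (2 * (d : ℝ) / N) ≤ ε := by
    rw [← mul_div_assoc]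
    exact (div_le_iff₀ hN).2 h
  calc (1 - ε) * N ^ n ≤ (1 + n * (-(2 * (d : ℝ) / N))) * N ^ n := by
        gcongr
        linarith
    _ ≤ (1 + -(2 * (d : ℝ) / N)) ^ n * N ^ n := by
        gcongr
        exact one_add_mul_le_pow (by linarith) n
    _ = (N - 2 * d) ^ n := by
        rw [← mul_pow]
        congr 1
        field_simp
        ring

theorem stmt14 (γ : ℝ) (hγ0 : 0 < γ) (hγ1 : γ < 1) (ε : ℝ) (hε : 0 < ε) :
    ∃ N₀ : ℕ, ∀ (G : Type) [Group G] [Fintype G] [DecidableEq G] (d : ℕ),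
      N₀ ≤ Fintype.card G → 2 ≤ d → (d : ℝ) ≤ dN γ (Fintype.card G) →
      ∀ x : G, x ≠ 1 →
      (1 - ε) * (Fintype.card G : ℝ) ^ (d - 1) / (d.factorial : ℝ) ≤ edgeCount d d x := by
  have hlog : Filter.Tendsto (fun N : ℕ => Real.log N) Filter.atTop Filter.atTop :=
    Real.tendsto_log_atTop.comp tendsto_natCast_atTop_atTop
  have hsmall : ∀ δ : ℝ, 0 < δ → ∀ᶠ N : ℕ in Filter.atTop, Real.log N ≤ δ * N := by
    intro δ hδ
    filter_upwards [tendsto_natCast_atTop_atTop.eventually (Real.isLittleO_log_id_atTop.bound hδ)]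
      with N hN
    simpa using (le_abs_self _).trans hN
  obtain ⟨N₀, hN₀⟩ := Filter.eventually_atTop.1
    (((Real.tendsto_log_atTop.comp hlog).eventually_ge_atTop 1).and
      ((hsmall (ε / 2) (by positivity)).and (hsmall (1 / 2) (by norm_num))))
  refine ⟨N₀, fun G _ _ _ d hG hd hdN x hx => ?_⟩
  obtain ⟨hll, hε', h2⟩ := hN₀ _ hG
  have hsq := sq_le_log_of_le_dN hγ0 hγ1 hll hdN
  have hd' : (2 : ℝ) ≤ d := by exact_mod_cast hd
  have h2d : 2 * (d : ℝ) ≤ Fintype.card G := by nlinarith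
  have hpos : (0 : ℝ) < Fintype.card G := by linarith
  have hcount : ((Fintype.card G : ℝ) - 2 * d) ^ (d - 1) ≤ d.factorial * edgeCount d d x := by
    have h2d' : 2 * d ≤ Fintype.card G := by exact_mod_cast h2d
    have := pow_le_factorial_mul_edgeCount hd hx
    have hcast : (((Fintype.card G - 2 * d) ^ (d - 1) : ℕ) : ℝ) ≤
        ((d.factorial * edgeCount d d x : ℕ) : ℝ) := by exact_mod_cast this
    simpa [Nat.cast_sub h2d'] using hcast
  rw [div_le_iff₀ (by positivity), mul_comm (edgeCount d d x : ℝ)]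
  refine (one_sub_mul_pow_le hpos h2d ?_).trans hcount
  have hd1 : ((d - 1 : ℕ) : ℝ) ≤ d := by exact_mod_cast Nat.sub_le d 1
  nlinarith
end
end

section
/- Fix γ ∈ (0,1) and let d_N = (1−γ)·√(log N/(2·log log N)). For every ε > 0 there exists N₀ such that for every N ≥ N₀, with G the cyclic group ℤ/Nℤ, every integer d with 2 ≤ d ≤ d_N, and every x ∈ G∖{1}: if x ≠ x⁻¹ then the number of d-edges of the diameter-d hypergraph Γ_x satisfies e_d(x) ≥ (1−ε)·2^d·N^(d−1)/d!, and if x = x⁻¹ then e_d(x) ≥ (1−ε)·2^(d−1)·N^(d−1)/d!. -/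
open scoped Classical

noncomputable section

section CyclicEdges

lemma zpow_unit_eq_one_iff {G : Type*} [Group G] (u : G) (s : ℤˣ) : u ^ (s : ℤ) = 1 ↔ u = 1 := by
  rcases Int.units_eq_one_or s with rfl | rfl <;> simp

variable {G : Type*} [CommGroup G] [Fintype G]

/-- The tuples whose signed product, with signs `a`, equals `x`. -/
def signedTuples {d : ℕ} (a : Fin d → ℤˣ) (x : G) : Finset (Fin d → G) :=
  Finset.univ.filter fun h => ∏ i, h i ^ (a i : ℤ) = x

lemma mem_signedTuples {d : ℕ} {a : Fin d → ℤˣ} {x : G} {h : Fin d → G} :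
    h ∈ signedTuples a x ↔ ∏ i, h i ^ (a i : ℤ) = x := by
  simp [signedTuples]

/-- A family of tuples is small if, once all coordinates but `i` and `j` are fixed, coordinate `j`
is determined up to an involution and determines coordinate `i`. -/
lemma card_le_of_two_coords [IsCyclic G] {d : ℕ} (S : Finset (Fin d → G)) {i j : Fin d}
    (hij : i ≠ j)
    (hS : ∀ h ∈ S, ∀ h' ∈ S, (∀ k, k ≠ i → k ≠ j → h k = h' k) →
      (h' j / h j) ^ 2 = 1 ∧ (h' j / h j = 1 → h' i / h i = 1)) :
    S.card ≤ 2 * Fintype.card G ^ (d - 2) := by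
  let r : (Fin d → G) → ({k : Fin d // k ∉ ({i, j} : Finset (Fin d))} → G) := fun h k => h k
  have hr : ∀ h h', r h = r h' → ∀ k, k ≠ i → k ≠ j → h k = h' k := by
    intro h h' e k hki hkj
    exact congrFun e ⟨k, by simp [hki, hkj]⟩
  have hcard : Fintype.card ({k : Fin d // k ∉ ({i, j} : Finset (Fin d))} → G)
      = Fintype.card G ^ (d - 2) := by
    rw [Fintype.card_fun, Fintype.card_subtype_compl (· ∈ ({i, j} : Finset (Fin d))),
      Fintype.card_coe, Finset.card_pair hij, Fintype.card_fin]
  rw [← hcard, ← Finset.card_univ]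
  refine Finset.card_le_mul_card_image_of_maps_to (f := r) (fun _ _ => Finset.mem_univ _) 2 ?_
  intro b _
  rcases (S.filter fun h => r h = b).eq_empty_or_nonempty with he | ⟨h₀, h₀m⟩
  · simp [he]
  obtain ⟨h₀S, h₀b⟩ := Finset.mem_filter.1 h₀m
  refine le_trans (Finset.card_le_card_of_injOn (t := Finset.univ.filter fun v : G => v ^ 2 = 1)
    (fun h => h j / h₀ j) ?_ ?_) (IsCyclic.card_pow_eq_one_le (by norm_num))
  · intro h hm
    obtain ⟨hS', hb⟩ := Finset.mem_filter.1 hm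
    simpa using (hS h₀ h₀S h hS' (hr _ _ (h₀b.trans hb.symm))).1
  · intro h hm h' hm' e
    obtain ⟨hS', hb⟩ := Finset.mem_filter.1 hm
    obtain ⟨hS'', hb'⟩ := Finset.mem_filter.1 hm'
    have hoff := hr h h' (hb.trans hb'.symm)
    have hj : h j = h' j := div_left_injective e
    have hi : h i = h' i := by
      have := (hS h hS' h' hS'' hoff).2 (by simp [hj])
      exact (div_eq_one.1 this).symm
    funext k
    by_cases hki : k = i
    · rw [hki, hi]
    by_cases hkj : k = j
    · rw [hkj, hj]
    exact hoff k hki hkj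

lemma zpow_mul_zpow_eq_one {d : ℕ} {a : Fin d → ℤˣ} {x : G} {h h' : Fin d → G} {i j : Fin d}
    (hij : i ≠ j) (hh : h ∈ signedTuples a x) (hh' : h' ∈ signedTuples a x)
    (hoff : ∀ k, k ≠ i → k ≠ j → h k = h' k) :
    (h' i / h i) ^ (a i : ℤ) * (h' j / h j) ^ (a j : ℤ) = 1 := by
  rw [mem_signedTuples] at hh hh'
  rw [← Finset.prod_eq_mul (s := Finset.univ) (f := fun k => (h' k / h k) ^ (a k : ℤ)) i j hij
    (fun k _ hk => by simp [hoff k hk.1 hk.2]) (by simp) (by simp)]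
  simp [div_zpow, Finset.prod_div_distrib, hh, hh']

lemma card_filter_coord_eq_one_le [IsCyclic G] {d : ℕ} (hd : 2 ≤ d) (a : Fin d → ℤˣ) (x : G)
    (i : Fin d) :
    ((signedTuples a x).filter fun h => h i = 1).card ≤ 2 * Fintype.card G ^ (d - 2) := by
  have : Nontrivial (Fin d) := Fin.nontrivial_iff_two_le.2 hd
  obtain ⟨j, hj⟩ := exists_ne i
  refine card_le_of_two_coords _ hj.symm ?_
  intro h hh h' hh' hoff
  rw [Finset.mem_filter] at hh hh'
  have := zpow_mul_zpow_eq_one hj.symm hh.1 hh'.1 hoff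
  simp only [hh.2, hh'.2, div_one, one_zpow, one_mul, zpow_unit_eq_one_iff] at this
  simp [this, hh.2, hh'.2]

lemma card_filter_coord_eq_coord_le [IsCyclic G] {d : ℕ} (a : Fin d → ℤˣ) {x : G}
    (hx : x ≠ 1) {i j : Fin d} (hij : i ≠ j) :
    ((signedTuples a x).filter fun h => h i = h j).card ≤ 2 * Fintype.card G ^ (d - 2) := by
  by_cases haij : a i = a j
  · refine card_le_of_two_coords _ hij ?_
    intro h hh h' hh' hoff
    rw [Finset.mem_filter] at hh hh'
    have := zpow_mul_zpow_eq_one hij hh.1 hh'.1 hoff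
    rw [hh.2, hh'.2, haij, ← mul_zpow, zpow_unit_eq_one_iff, ← sq] at this
    rw [hh.2, hh'.2]
    exact ⟨this, id⟩
  by_cases hk : ∃ k, k ≠ i ∧ k ≠ j
  · obtain ⟨k, hki, hkj⟩ := hk
    refine card_le_of_two_coords _ hki.symm ?_
    intro h hh h' hh' hoff
    rw [Finset.mem_filter] at hh hh'
    have := zpow_mul_zpow_eq_one hki.symm hh.1 hh'.1 hoff
    have hui : h' i / h i = 1 := by
      rw [hh.2, hh'.2, hoff j hij.symm hkj.symm, div_self']
    rw [hui, one_zpow, one_mul, zpow_unit_eq_one_iff] at this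
    simp [this, hui]
  · push Not at hk
    have : ((signedTuples a x).filter fun h => h i = h j) = ∅ := by
      rw [Finset.filter_eq_empty_iff]
      intro h hh e
      rw [mem_signedTuples, Finset.prod_eq_mul (s := Finset.univ) i j hij
        (fun k _ hk' => absurd (hk k hk'.1) hk'.2) (by simp) (by simp), e] at hh
      apply hx
      rw [← hh]
      rcases Int.units_eq_one_or (a i) with h1 | h1 <;>
        rcases Int.units_eq_one_or (a j) with h2 | h2 <;> simp_all
    simp [this]

lemma card_signedTuples_inter_le [IsCyclic G] {d : ℕ} {a b : Fin d → ℤˣ} (x : G)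
    (hab : a ≠ b) (hj : ∃ j, a j = b j) :
    (signedTuples a x ∩ signedTuples b x).card ≤ 2 * Fintype.card G ^ (d - 2) := by
  obtain ⟨j, hj⟩ := hj
  obtain ⟨i, hi⟩ := Function.ne_iff.1 hab
  have hij : i ≠ j := by rintro rfl; exact hi hj
  refine card_le_of_two_coords _ hij ?_
  intro h hh h' hh' hoff
  rw [Finset.mem_inter] at hh hh'
  have h1 := zpow_mul_zpow_eq_one hij hh.1 hh'.1 hoff
  have h2 := zpow_mul_zpow_eq_one hij hh.2 hh'.2 hoff
  rw [← hj, ← neg_eq_iff_eq_neg.2 (Int.units_ne_iff_eq_neg.1 hi)] at h2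
  refine ⟨?_, fun e => ?_⟩
  · rw [← zpow_unit_eq_one_iff _ (a j)]
    have h3 := congrArg₂ (· * ·) h1 h2
    simp only [Units.val_neg, zpow_neg, mul_one] at h3
    rw [mul_mul_mul_comm, mul_inv_cancel, one_mul, ← mul_zpow, ← sq] at h3
    exact h3
  · rwa [e, one_zpow, mul_one, zpow_unit_eq_one_iff] at h1

lemma pow_le_card_signedTuples {n : ℕ} (a : Fin (n + 1) → ℤˣ) (x : G) :
    Fintype.card G ^ n ≤ (signedTuples a x).card := by
  have : Fintype.card G ^ n = (Finset.univ : Finset (Fin n → G)).card := by simp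
  rw [this]
  refine Finset.card_le_card_of_injOn
    (fun g => Fin.cons ((x / ∏ i, g i ^ (a i.succ : ℤ)) ^ (a 0 : ℤ)) g) ?_ ?_
  · intro g _
    simp only [Finset.mem_coe, mem_signedTuples, Fin.prod_univ_succ, Fin.cons_zero, Fin.cons_succ]
    rw [← zpow_mul, ← Units.val_mul, Int.units_mul_self]
    simp
  · intro g _ g' _ e
    exact (Fin.cons_injective2 e).2

/-- The injective tuples avoiding the identity with signed product `x` for some choice of signs. -/
def edgeTuples (d : ℕ) (x : G) : Finset (Fin d → G) :=
  Finset.univ.filter fun h => Function.Injective h ∧ (∀ i, h i ≠ 1) ∧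
    ∃ a : Fin d → ℤˣ, h ∈ signedTuples a x

lemma card_edgeTuples_le (d : ℕ) (x : G) :
    (edgeTuples d x).card ≤ d.factorial * edgeCount d d x := by
  refine Finset.card_le_mul_card_image_of_maps_to (f := fun h => Finset.univ.image h) ?_ _ ?_
  · intro h hh
    simp only [edgeTuples, Finset.mem_filter, Finset.mem_univ, true_and] at hh
    obtain ⟨hinj, h1, a, ha⟩ := hh
    have hc : (Finset.univ.image h).card = d := by
      rw [Finset.card_image_of_injective _ hinj]; simp
    simp only [Finset.mem_filter, Finset.mem_univ, true_and]
    refine ⟨hc, by simpa using h1, d, hc.le, le_rfl, h, fun i => a i, by simp, by simp,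
      fun i => ?_, ?_⟩
    · rcases Int.units_eq_one_or (a i) with h | h <;> simp [h]
    · rw [List.prod_ofFn]
      exact mem_signedTuples.1 ha
  · intro E hE
    have hEc : Fintype.card E = d := by simpa using (Finset.mem_filter.1 hE).2.1
    have hd : Fintype.card (Fin d ↪ E) = d.factorial := by
      rw [Fintype.card_embedding_eq, hEc, Fintype.card_fin, Nat.descFactorial_self]
    rw [← hd, ← Fintype.card_coe]
    have key : ∀ h ∈ (edgeTuples d x).filter fun h => Finset.univ.image h = E,
        Function.Injective h ∧ ∀ i, h i ∈ E := by
      intro h hh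
      obtain ⟨h1, rfl⟩ := Finset.mem_filter.1 hh
      exact ⟨(Finset.mem_filter.1 h1).2.1, by simp⟩
    refine Fintype.card_le_of_injective
      (fun h => (⟨fun i => ⟨h.1 i, (key _ h.2).2 i⟩,
        fun i j e => (key _ h.2).1 (congrArg Subtype.val e)⟩ : Fin d ↪ E)) ?_
    intro h h' e
    ext i
    exact congrArg Subtype.val (DFunLike.congr_fun e i)

lemma card_mul_pow_le_factorial_mul_edgeCount [IsCyclic G] {n : ℕ} {x : G} (hx : x ≠ 1)
    (A : Finset (Fin (n + 2) → ℤˣ))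
    (hA : ∀ a ∈ A, ∀ b ∈ A, (signedTuples a x ∩ signedTuples b x).Nonempty → ∃ j, a j = b j) :
    A.card * Fintype.card G ^ (n + 1) ≤ (n + 2).factorial * edgeCount (n + 2) (n + 2) x +
      A.card * (((n + 2) + (n + 2) ^ 2 + 2 ^ (n + 2)) * (2 * Fintype.card G ^ n)) := by
  set M := 2 * Fintype.card G ^ n with hM
  let B₁ := fun a : Fin (n + 2) → ℤˣ =>
    Finset.univ.biUnion fun i => (signedTuples a x).filter fun h => h i = 1
  let B₂ := fun a : Fin (n + 2) → ℤˣ =>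
    Finset.univ.biUnion fun p : Fin (n + 2) × Fin (n + 2) =>
      (signedTuples a x).filter fun h => p.1 ≠ p.2 ∧ h p.1 = h p.2
  let B₃ := fun a : Fin (n + 2) → ℤˣ =>
    A.biUnion fun b => (signedTuples a x).filter fun h => a ≠ b ∧ h ∈ signedTuples b x
  let U := fun a => signedTuples a x \ (B₁ a ∪ B₂ a ∪ B₃ a)
  have hB₁ : ∀ a, (B₁ a).card ≤ (n + 2) * M := fun a => by
    simpa using Finset.card_biUnion_le_card_mul Finset.univ _ M
      fun i _ => card_filter_coord_eq_one_le (by omega) a x i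
  have hB₂ : ∀ a, (B₂ a).card ≤ (n + 2) ^ 2 * M := fun a => by
    have := Finset.card_biUnion_le_card_mul Finset.univ
      (fun p : Fin (n + 2) × Fin (n + 2) =>
        (signedTuples a x).filter fun h => p.1 ≠ p.2 ∧ h p.1 = h p.2) M fun p _ => by
        by_cases hp : p.1 = p.2
        · simp [hp]
        · simpa [hp] using card_filter_coord_eq_coord_le a hx hp
    simpa [sq] using this
  have hAc : A.card ≤ 2 ^ (n + 2) := by
    simpa using Finset.card_le_univ A
  have hB₃ : ∀ a ∈ A, (B₃ a).card ≤ 2 ^ (n + 2) * M := fun a ha => by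
    refine le_trans (Finset.card_biUnion_le_card_mul A _ M fun b hb => ?_)
      (Nat.mul_le_mul_right _ hAc)
    by_cases hab : a = b
    · simp [hab]
    rcases (signedTuples a x ∩ signedTuples b x).eq_empty_or_nonempty with he | hne
    · simp [hab, Finset.filter_mem_eq_inter, he]
    · simpa [hab, Finset.filter_mem_eq_inter] using
        card_signedTuples_inter_le x hab (hA a ha b hb hne)
  have hU : ∀ a ∈ A, Fintype.card G ^ (n + 1) ≤
      (U a).card + ((n + 2) + (n + 2) ^ 2 + 2 ^ (n + 2)) * M := fun a ha => by
    have h1 := pow_le_card_signedTuples (n := n + 1) a x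
    have h2 : (signedTuples a x).card ≤ (U a).card + (B₁ a ∪ B₂ a ∪ B₃ a).card :=
      Finset.card_le_card_sdiff_add_card
    have h3 := Finset.card_union_le (B₁ a ∪ B₂ a) (B₃ a)
    have h4 := Finset.card_union_le (B₁ a) (B₂ a)
    have := hB₁ a
    have := hB₂ a
    have := hB₃ a ha
    linarith
  have hdisj : (A : Set (Fin (n + 2) → ℤˣ)).PairwiseDisjoint U := by
    intro a ha b hb hab
    refine Finset.disjoint_left.2 fun h h1 h2 => ?_
    obtain ⟨h1, h3⟩ := Finset.mem_sdiff.1 h1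
    apply h3
    refine Finset.mem_union_right _ (Finset.mem_biUnion.2 ⟨b, hb, Finset.mem_filter.2
      ⟨h1, hab, (Finset.mem_sdiff.1 h2).1⟩⟩)
  have hsub : A.biUnion U ⊆ edgeTuples (n + 2) x := by
    intro h hh
    obtain ⟨a, -, ha⟩ := Finset.mem_biUnion.1 hh
    obtain ⟨h1, h2⟩ := Finset.mem_sdiff.1 ha
    simp only [B₁, B₂, Finset.mem_union, Finset.mem_biUnion, Finset.mem_filter, Finset.mem_univ,
      true_and, not_or, not_exists, not_and] at h2
    refine Finset.mem_filter.2 ⟨Finset.mem_univ _, fun i j e => ?_, fun i => h2.1.1 i h1, a, h1⟩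
    by_contra hij
    exact h2.1.2 (i, j) h1 hij e
  have h1 : ∑ a ∈ A, (U a).card ≤ (n + 2).factorial * edgeCount (n + 2) (n + 2) x := by
    rw [← Finset.card_biUnion hdisj]
    exact (Finset.card_le_card hsub).trans (card_edgeTuples_le _ _)
  have h2 := Finset.sum_le_sum hU
  simp only [Finset.sum_add_distrib, Finset.sum_const, smul_eq_mul] at h2
  linarith

lemma one_sub_mul_card_mul_pow_le [IsCyclic G] {d : ℕ} (hd : 2 ≤ d) {x : G} (hx : x ≠ 1)
    {ε : ℝ} (hε : 6 * (4 : ℝ) ^ d ≤ ε * Fintype.card G) (A : Finset (Fin d → ℤˣ))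
    (hA : ∀ a ∈ A, ∀ b ∈ A, (signedTuples a x ∩ signedTuples b x).Nonempty → ∃ j, a j = b j) :
    (1 - ε) * A.card * (Fintype.card G : ℝ) ^ (d - 1) / (d.factorial : ℝ) ≤ edgeCount d d x := by
  obtain ⟨n, rfl⟩ := Nat.exists_eq_add_of_le' hd
  have key := card_mul_pow_le_factorial_mul_edgeCount hx A hA
  have hK : (n + 2) + (n + 2) ^ 2 + 2 ^ (n + 2) ≤ 3 * 4 ^ (n + 2) := by
    have h1 : n + 2 < 2 ^ (n + 2) := Nat.lt_two_pow_self
    have h2 : (2 ^ (n + 2)) ^ 2 = 4 ^ (n + 2) := by rw [← pow_mul, mul_comm, pow_mul]; norm_num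
    nlinarith
  have key' : (A.card : ℝ) * (Fintype.card G : ℝ) ^ (n + 1) ≤
      (n + 2).factorial * edgeCount (n + 2) (n + 2) x +
      A.card * (3 * 4 ^ (n + 2) * (2 * (Fintype.card G : ℝ) ^ n)) := by
    have := key.trans (Nat.add_le_add_left (Nat.mul_le_mul_left A.card
      (Nat.mul_le_mul_right (2 * Fintype.card G ^ n) hK)) _)
    exact_mod_cast this
  rw [div_le_iff₀ (by positivity)]
  have h3 : (A.card : ℝ) * (Fintype.card G : ℝ) ^ n * (6 * (4 : ℝ) ^ (n + 2)) ≤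
      A.card * (Fintype.card G : ℝ) ^ n * (ε * Fintype.card G) := by gcongr
  rw [show n + 2 - 1 = n + 1 by omega]
  have h4 : (Fintype.card G : ℝ) ^ (n + 1) = (Fintype.card G : ℝ) ^ n * Fintype.card G :=
    pow_succ _ _
  rw [h4] at key' ⊢
  linarith

lemma exists_eq_of_ne_inv {d : ℕ} {x : G} (hx : x ≠ x⁻¹) (a b : Fin d → ℤˣ)
    (hne : (signedTuples a x ∩ signedTuples b x).Nonempty) : ∃ j, a j = b j := by
  obtain ⟨h, hh⟩ := hne
  simp only [Finset.mem_inter, mem_signedTuples] at hh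
  by_contra! hab
  apply hx
  rw [← hh.1, ← Finset.prod_inv_distrib]
  conv_lhs => rw [hh.1, ← hh.2]
  refine Finset.prod_congr rfl fun i _ => ?_
  rw [Int.units_ne_iff_eq_neg.1 (hab i)]
  simp

lemma card_filter_zero_eq_one (n : ℕ) :
    (Finset.univ.filter fun a : Fin (n + 1) → ℤˣ => a 0 = 1).card = 2 ^ n := by
  have : (Finset.univ.filter fun a : Fin (n + 1) → ℤˣ => a 0 = 1)
      = Finset.univ.image fun g : Fin n → ℤˣ => (Fin.cons 1 g : Fin (n + 1) → ℤˣ) := by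
    ext a
    simp only [Finset.mem_filter, Finset.mem_univ, true_and, Finset.mem_image]
    refine ⟨fun h => ⟨Fin.tail a, by rw [← h, Fin.cons_self_tail]⟩, ?_⟩
    rintro ⟨g, rfl⟩
    rfl
  rw [this, Finset.card_image_of_injective _ (Fin.cons_right_injective _)]
  simp

end CyclicEdges

lemma six_mul_four_pow_le {γ : ℝ} (hγ0 : 0 < γ) {ε : ℝ} (hε : 0 < ε) {N d : ℕ}
    (hN : Real.exp 16 ≤ N) (hNε : (6 / ε) ^ 2 ≤ N) (hd : (d : ℝ) ≤ dN γ N) :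
    6 * (4 : ℝ) ^ d ≤ ε * N := by
  have hN0 : (0 : ℝ) < N := (Real.exp_pos _).trans_le hN
  have hL : 16 ≤ Real.log N := (Real.le_log_iff_exp_le hN0).2 hN
  have hlog2 := Real.log_two_gt_d9
  have hlog2' := Real.log_two_lt_d9
  have hLL : 1 / 2 ≤ Real.log (Real.log N) := by
    have := Real.log_le_log (by norm_num) ((by norm_num : (2 : ℝ) ≤ 16).trans hL)
    linarith
  have hd' : (d : ℝ) ≤ Real.sqrt (Real.log N) := by
    refine hd.trans ?_
    unfold dN
    calc _ ≤ 1 * Real.sqrt (Real.log N / (2 * Real.log (Real.log N))) := by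
          gcongr; linarith
      _ ≤ _ := by
          rw [one_mul]
          exact Real.sqrt_le_sqrt (div_le_self (by linarith) (by linarith))
  have hs : 4 ≤ Real.sqrt (Real.log N) := Real.le_sqrt_of_sq_le (by linarith)
  have hsq := Real.sq_sqrt (show 0 ≤ Real.log N by linarith)
  have h4 : (4 : ℝ) ^ d ≤ Real.sqrt N := by
    rw [Real.le_sqrt (by positivity) hN0.le, ← Real.log_le_log_iff (by positivity) hN0,
      Real.log_pow, Real.log_pow, show (4 : ℝ) = 2 ^ 2 by norm_num, Real.log_pow]
    push_cast
    have : (d : ℝ) * Real.log 2 ≤ Real.sqrt (Real.log N) * 1 := by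
      gcongr; linarith
    nlinarith
  have h6 : 6 / ε ≤ Real.sqrt N := Real.le_sqrt_of_sq_le hNε
  rw [div_le_iff₀ hε] at h6
  calc 6 * (4 : ℝ) ^ d ≤ (Real.sqrt N * ε) * Real.sqrt N := by gcongr
    _ = ε * N := by rw [mul_right_comm, Real.mul_self_sqrt hN0.le, mul_comm]

theorem stmt15 (γ : ℝ) (hγ0 : 0 < γ) (hγ1 : γ < 1) (ε : ℝ) (hε : 0 < ε) :
    ∃ N₀ : ℕ, ∀ (G : Type) [Group G] [Fintype G] [DecidableEq G], IsCyclic G → ∀ d : ℕ,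
      N₀ ≤ Fintype.card G → 2 ≤ d → (d : ℝ) ≤ dN γ (Fintype.card G) →
      ∀ x : G, x ≠ 1 →
      (x ≠ x⁻¹ →
        (1 - ε) * 2 ^ d * (Fintype.card G : ℝ) ^ (d - 1) / (d.factorial : ℝ)
          ≤ edgeCount d d x) ∧
      (x = x⁻¹ →
        (1 - ε) * 2 ^ (d - 1) * (Fintype.card G : ℝ) ^ (d - 1) / (d.factorial : ℝ)
          ≤ edgeCount d d x) := by
  refine ⟨⌈max (Real.exp 16) ((6 / ε) ^ 2)⌉₊, ?_⟩
  intro G _ _ _ hG d hN hd hdN x hx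
  let _ : CommGroup G := IsCyclic.commGroup
  have hN' := Nat.ceil_le.1 hN
  have hK := six_mul_four_pow_le hγ0 hε ((le_max_left _ _).trans hN')
    ((le_max_right _ _).trans hN') hdN
  refine ⟨fun hxi => ?_, fun _ => ?_⟩
  · have := one_sub_mul_card_mul_pow_le hd hx hK Finset.univ
      fun a _ b _ => exists_eq_of_ne_inv hxi a b
    simpa using this
  · obtain ⟨n, rfl⟩ := Nat.exists_eq_add_of_le' hd
    have := one_sub_mul_card_mul_pow_le hd hx hK (Finset.univ.filter fun a => a 0 = 1)
      fun a ha b hb _ => ⟨0, (Finset.mem_filter.1 ha).2.trans (Finset.mem_filter.1 hb).2.symm⟩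
    rw [card_filter_zero_eq_one (n + 1)] at this
    simpa using this
end
end

section
/- Let G be a finite group of order N, let d ≥ 2 be an integer, let x ∈ G∖{1}, and let i be an integer with 1 ≤ i ≤ d−1. Then the number of ordered pairs (e, f) of d-edges of the diameter-d hypergraph Γ_x with |e ∩ f| = i is at most 2^(2d) · C(d,i)² · i! · N^(2d−i−2), where C(d,i) is the binomial coefficient. -/
open scoped Classical

noncomputable section

/-- A product of group elements is injective in each of its factors. -/
theorem eq_of_prod_ofFn_eq {G : Type*} [Group G] {n : ℕ} {f g : Fin n → G} {p : Fin n}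
    (hfg : ∀ j, j ≠ p → f j = g j) (h : (List.ofFn f).prod = (List.ofFn g).prod) :
    f p = g p := by
  induction n with
  | zero => exact p.elim0
  | succ n ih =>
    rw [List.ofFn_succ, List.ofFn_succ, List.prod_cons, List.prod_cons] at h
    induction p using Fin.cases with
    | zero =>
      have htail : (fun j : Fin n => f j.succ) = fun j => g j.succ :=
        funext fun j => hfg _ (Fin.succ_ne_zero j)
      rw [htail] at h
      exact mul_right_cancel h
    | succ q =>
      rw [hfg 0 (Fin.succ_ne_zero q).symm] at h
      exact ih (f := fun j => f j.succ) (g := fun j => g j.succ)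
        (fun j hj => hfg _ fun hs => hj (Fin.succ_injective _ hs)) (mul_left_cancel h)

theorem zpow_intUnits_injective {G : Type*} [Group G] (u : ℤˣ) :
    Function.Injective fun g : G => g ^ (u : ℤ) := by
  intro g h hgh
  rcases Int.units_eq_one_or u with rfl | rfl <;> simpa using hgh

/-- Once the letters of a signed word at the positions in `T` are prescribed, prescribing the
value of the word as well leaves at most `|G| ^ (n - |T| - 1)` words. -/
theorem card_words_le {G : Type*} [Group G] [Fintype G] {n : ℕ} (a : Fin n → ℤˣ) (x : G)
    (T : Finset (Fin n)) (hT : T.card < n) (g : Fin n → G) :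
    (Finset.univ.filter fun h : Fin n → G =>
      (∀ t ∈ T, h t = g t) ∧ (List.ofFn fun j => h j ^ (a j : ℤ)).prod = x).card ≤
      Fintype.card G ^ (n - T.card - 1) := by
  obtain ⟨p, hp⟩ : ∃ p, p ∉ T := by
    by_contra! hall
    rw [Finset.eq_univ_iff_forall.mpr hall, Finset.card_univ, Fintype.card_fin] at hT
    exact lt_irrefl _ hT
  have hcard : Fintype.card ({j // j ∈ (insert p T)ᶜ} → G) =
      Fintype.card G ^ (n - T.card - 1) := by
    rw [Fintype.card_fun, Fintype.card_coe, Finset.card_compl, Fintype.card_fin,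
      Finset.card_insert_of_notMem hp, Nat.sub_sub]
  rw [← hcard, ← Finset.card_univ]
  refine Finset.card_le_card_of_injOn (fun h j => h j.1) (fun _ _ => Finset.mem_univ _) ?_
  intro h hh k hk hhk
  simp only [Finset.coe_filter, Finset.mem_univ, true_and, Set.mem_ofPred_eq] at hh hk
  have hoff : ∀ j, j ≠ p → h j = k j := by
    intro j hj
    by_cases hjT : j ∈ T
    · rw [hh.1 j hjT, hk.1 j hjT]
    · exact congrFun hhk ⟨j, by simp [hj, hjT]⟩
  funext j
  by_cases hj : j = p
  · subst hj
    exact zpow_intUnits_injective (a j) (eq_of_prod_ofFn_eq (f := fun j => h j ^ (a j : ℤ))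
      (g := fun j => k j ^ (a j : ℤ)) (fun l hl => by simp only [hoff l hl])
      (hh.2.trans hk.2.symm))
  · exact hoff j hj

/-- Pairs of signed words with value `x` that share `i` letters at prescribed positions. -/
theorem card_word_pairs_le {G : Type*} [Group G] [Fintype G] {n i : ℕ} (hi : i < n)
    (a b : Fin n → ℤˣ) (x : G) (s t : Fin i ↪ Fin n) :
    (Finset.univ.filter fun w : (Fin n → G) × (Fin n → G) =>
      (List.ofFn fun j => w.1 j ^ (a j : ℤ)).prod = x ∧
      (List.ofFn fun j => w.2 j ^ (b j : ℤ)).prod = x ∧ ∀ k, w.2 (t k) = w.1 (s k)).card ≤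
      Fintype.card G ^ (2 * n - i - 2) := by
  have hfirst := card_words_le a x ∅ (by simp; omega) 1
  have hpow : Fintype.card G ^ (2 * n - i - 2) =
      Fintype.card G ^ (n - i - 1) * Fintype.card G ^ (n - 1) := by
    rw [← pow_add]; congr 1; omega
  rw [hpow]
  simp only [Finset.notMem_empty, false_imp_iff, implies_true, true_and, Finset.card_empty,
    Nat.sub_zero] at hfirst
  refine le_trans (Finset.card_le_mul_card_image_of_maps_to (f := Prod.fst)
    (t := Finset.univ.filter fun h : Fin n → G =>
      (List.ofFn fun j => h j ^ (a j : ℤ)).prod = x) ?_ (Fintype.card G ^ (n - i - 1)) ?_)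
    (Nat.mul_le_mul_left _ hfirst)
  · intro w hw
    simp only [Finset.mem_filter, Finset.mem_univ, true_and] at hw ⊢
    exact hw.1
  · intro h _
    have hT : (Finset.univ.map t).card = i := by simp
    have hsecond := card_words_le b x (Finset.univ.map t) (by rwa [hT])
      (Function.extend t (h ∘ s) 1)
    rw [hT] at hsecond
    refine le_trans (Finset.card_le_card_of_injOn Prod.snd ?_ ?_) hsecond
    · rintro ⟨w, v⟩ hw
      simp only [Finset.coe_filter, Finset.mem_filter, Finset.mem_univ, true_and,
        Set.mem_ofPred_eq] at hw
      obtain ⟨⟨-, hv, hshare⟩, rfl⟩ := hw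
      simp only [Finset.coe_filter, Finset.mem_univ, true_and, Set.mem_ofPred_eq]
      refine ⟨fun j hj => ?_, hv⟩
      obtain ⟨k, -, rfl⟩ := Finset.mem_map.mp hj
      rw [t.injective.extend_apply, hshare k, Function.comp_apply]
    · intro w hw v hv hwv
      exact Prod.ext ((Finset.mem_filter.mp hw).2.trans (Finset.mem_filter.mp hv).2.symm) hwv

/-- A `d`-edge is the set of letters of a signed word of length `d` without repetitions. -/
theorem IsEdge.exists_word {G : Type*} [Group G] {d : ℕ} {x : G} {E : Finset G}
    (hE : IsEdge d x E) (hcard : E.card = d) :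
    ∃ (h : Fin d → G) (a : Fin d → ℤˣ), Function.Injective h ∧ Finset.univ.image h = E ∧
      (List.ofFn fun j => h j ^ (a j : ℤ)).prod = x := by
  obtain ⟨-, l, hl, hld, h, a, hmem, hcov, ha, hprod⟩ := hE
  obtain rfl : l = d := by omega
  have himage : Finset.univ.image h = E := by
    ext g
    simp only [Finset.mem_image, Finset.mem_univ, true_and]
    exact ⟨fun ⟨j, hj⟩ => hj ▸ hmem j, hcov g⟩
  refine ⟨h, fun j => if a j = 1 then 1 else -1, ?_, himage, ?_⟩
  · rw [← Set.injOn_univ, ← Finset.coe_univ, ← Finset.card_image_iff, himage, hcard]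
    simp
  · rw [← hprod]
    congr 2
    funext j
    rcases ha j with hj | hj <;> simp [hj]

theorem stmt16 (G : Type*) [Group G] [Fintype G] [DecidableEq G] (d : ℕ) (hd : 2 ≤ d)
    (x : G) (hx : x ≠ 1) (i : ℕ) (hi1 : 1 ≤ i) (hid : i ≤ d - 1) :
    (Finset.univ.filter fun ef : Finset G × Finset G =>
        (ef.1.card = d ∧ IsEdge d x ef.1) ∧ (ef.2.card = d ∧ IsEdge d x ef.2) ∧
        (ef.1 ∩ ef.2).card = i).card ≤
      2 ^ (2 * d) * (d.choose i) ^ 2 * i.factorial * Fintype.card G ^ (2 * d - i - 2) := by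
  let Idx := ((Fin d → ℤˣ) × (Fin d → ℤˣ)) ×
    ({S : Finset (Fin d) // S.card = i} × (Fin i ↪ Fin d))
  let pairs : Idx → Finset ((Fin d → G) × (Fin d → G)) := fun c =>
    Finset.univ.filter fun w =>
      (List.ofFn fun j => w.1 j ^ (c.1.1 j : ℤ)).prod = x ∧
      (List.ofFn fun j => w.2 j ^ (c.1.2 j : ℤ)).prod = x ∧
      ∀ k, w.2 (c.2.2 k) = w.1 ((c.2.1.1.orderEmbOfFin c.2.1.2).toEmbedding k)
  let letters : (Fin d → G) × (Fin d → G) → Finset G × Finset G := fun w =>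
    (Finset.univ.image w.1, Finset.univ.image w.2)
  have hidx : Fintype.card Idx = 2 ^ (2 * d) * (d.choose i) ^ 2 * i.factorial := by
    simp only [Idx, Fintype.card_prod, Fintype.card_fun, Fintype.card_fin, Fintype.card_units_int,
      Fintype.card_finset_len, Fintype.card_embedding_eq, Nat.descFactorial_eq_factorial_mul_choose]
    ring
  have hpairs (c : Idx) : (pairs c).card ≤ Fintype.card G ^ (2 * d - i - 2) := by
    convert card_word_pairs_le (by omega : i < d) c.1.1 c.1.2 x
      (c.2.1.1.orderEmbOfFin c.2.1.2).toEmbedding c.2.2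
  rw [← hidx]
  refine le_trans (Finset.card_le_card (t := Finset.univ.biUnion fun c => (pairs c).image letters)
    ?_) (Finset.card_biUnion_le_card_mul _ _ _ fun c _ =>
      Finset.card_image_le.trans (hpairs c))
  rintro ⟨e, f⟩ hef
  simp only [Finset.mem_filter, Finset.mem_univ, true_and] at hef
  obtain ⟨⟨hecard, he⟩, ⟨hfcard, hf⟩, hinter⟩ := hef
  obtain ⟨h, a, hinj, himage, hprod⟩ := he.exists_word hecard
  obtain ⟨h', b, hinj', himage', hprod'⟩ := hf.exists_word hfcard
  let S : Finset (Fin d) := Finset.univ.filter fun j => h j ∈ f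
  have hS : S.card = i := by
    rw [← hinter, ← Finset.card_image_of_injective S hinj]
    congr 1
    ext g
    simp only [← himage, S, Finset.mem_image, Finset.mem_filter, Finset.mem_univ, true_and,
      Finset.mem_inter]
    exact ⟨fun ⟨j, hj, hg⟩ => hg ▸ ⟨⟨j, rfl⟩, hj⟩, fun ⟨⟨j, hg⟩, hgf⟩ => ⟨j, hg ▸ hgf, hg⟩⟩
  have hmatch : ∀ k, ∃ j, h' j = h (S.orderEmbOfFin hS k) := by
    intro k
    have hk := (Finset.mem_filter.mp (S.orderEmbOfFin_mem hS k)).2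
    rw [← himage'] at hk
    simpa using hk
  choose u hu using hmatch
  have huinj : Function.Injective u := fun k l hkl =>
    (S.orderEmbOfFin hS).injective (hinj (by rw [← hu, ← hu, hkl]))
  simp only [Finset.mem_biUnion, Finset.mem_univ, true_and, Finset.mem_image]
  refine ⟨((a, b), (⟨S, hS⟩, ⟨u, huinj⟩)), (h, h'), ?_, ?_⟩
  · simp only [pairs, Finset.mem_filter, Finset.mem_univ, true_and]
    exact ⟨hprod, hprod', hu⟩
  · simp only [letters, Prod.mk.injEq]
    exact ⟨by convert himage, by convert himage'⟩
end
end

section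
/- Let G be a finite group of order N, let d ≥ 2 be an integer, and let δ > 0 satisfy N^δ ≥ 4^(d+2)·d^(d+3). Then the δ-dependency graph H has an independent set I of size at least N^(1−3δ) such that, in addition, for every x ∈ I and every integer 1 ≤ k ≤ d, the diameter-d hypergraph Γ_x has at most N^(k−1+δ) edges of size k. -/
open scoped Classical

noncomputable section

/-- The number of pairs `(e,f)` where `e` is an `r`-edge of `Γ_x`, `f` is an `s`-edge
of `Γ_y`, and `|e ∩ f| = t`. -/
def crossPairCount {G : Type*} [Group G] [Fintype G] [DecidableEq G]
    (d : ℕ) (x y : G) (r s t : ℕ) : ℕ :=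
  (Finset.univ.filter fun ef : Finset G × Finset G =>
      ef.1.card = r ∧ IsEdge d x ef.1 ∧ ef.2.card = s ∧ IsEdge d y ef.2 ∧
      (ef.1 ∩ ef.2).card = t).card

/-- Adjacency in the `δ`-dependency graph `H`. -/
def depAdj {G : Type*} [Group G] [Fintype G] [DecidableEq G]
    (d : ℕ) (δ : ℝ) (x y : G) : Prop :=
  ∃ r s t : ℕ, 1 ≤ t ∧ t ≤ r ∧ r ≤ d ∧ t ≤ s ∧ s ≤ d ∧
    (Fintype.card G : ℝ) ^ ((r : ℝ) + (s : ℝ) - (t : ℝ) - 1 - δ) ≤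
      (crossPairCount d x y r s t : ℝ)

open Finset Pointwise in
/-- The elements having `E` as an edge are products of `d` factors from `E ∪ E⁻¹ ∪ {1}`. -/
theorem IsEdge.mem_pow {G : Type*} [Group G] [DecidableEq G] {d : ℕ} {x : G} {E : Finset G}
    (h : IsEdge d x E) : x ∈ (insert 1 (E ∪ E⁻¹)) ^ d := by
  obtain ⟨-, ℓ, -, hℓ, w, a, hw, -, ha, rfl⟩ := h
  refine Finset.pow_subset_pow_right (Finset.mem_insert_self _ _) hℓ ?_
  rw [Finset.mem_pow]
  refine ⟨fun i => ⟨w i ^ a i, ?_⟩, rfl⟩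
  rcases ha i with h | h <;> simp [h, hw i]

/-- A set of size at most `d` is an edge of at most `(2d+1)^d` of the hypergraphs `Γ_x`. -/
theorem card_filter_isEdge_le {G : Type*} [Group G] [Fintype G] {d : ℕ}
    {E : Finset G} (hE : E.card ≤ d) :
    (Finset.univ.filter fun x : G => IsEdge d x E).card ≤ (2 * d + 1) ^ d := by
  open Pointwise in
  calc (Finset.univ.filter fun x : G => IsEdge d x E).card
      ≤ ((insert 1 (E ∪ E⁻¹)) ^ d).card := Finset.card_le_card fun x hx =>
        IsEdge.mem_pow (Finset.mem_filter.1 hx).2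
    _ ≤ (insert 1 (E ∪ E⁻¹)).card ^ d := Finset.card_pow_le
    _ ≤ (2 * d + 1) ^ d := by
        refine Nat.pow_le_pow_left ?_ _
        have h1 := Finset.card_insert_le 1 (E ∪ E⁻¹)
        have h2 := Finset.card_union_le E E⁻¹
        have h3 : (E⁻¹).card = E.card := Finset.card_inv E
        omega

/-- Double counting of the `k`-edges of all the hypergraphs `Γ_x`. -/
theorem sum_edgeCount_le {G : Type*} [Group G] [Fintype G] {d k : ℕ} (hk : k ≤ d) :
    ∑ x : G, edgeCount d k x ≤ Fintype.card G ^ k * (2 * d + 1) ^ d := by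
  have h : ∑ x : G, edgeCount d k x =
      ∑ E ∈ Finset.powersetCard k (Finset.univ : Finset G),
        (Finset.univ.filter fun x : G => IsEdge d x E).card := by
    simp only [edgeCount, Finset.card_filter, ← Finset.powerset_univ, Finset.powersetCard_eq_filter,
      Finset.sum_filter]
    rw [Finset.sum_comm]
    refine Finset.sum_congr rfl fun E _ => ?_
    by_cases hE : E.card = k <;> simp [hE]
  rw [h]
  calc _ ≤ (Finset.powersetCard k (Finset.univ : Finset G)).card • (2 * d + 1) ^ d :=
        Finset.sum_le_card_nsmul _ _ _ fun E hE =>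
          card_filter_isEdge_le ((Finset.mem_powersetCard.1 hE).2.trans_le hk)
    _ ≤ _ := by
        rw [Finset.card_powersetCard, smul_eq_mul, Finset.card_univ]
        exact Nat.mul_le_mul_right _ (Nat.choose_le_pow _ _)

/-- There are at most `n ^ (r + s - t)` pairs of sets of sizes `r`, `s` with `t` common points. -/
theorem card_pairs_inter_le {α : Type*} [Fintype α] [DecidableEq α] {r s t : ℕ}
    (hr : t ≤ r) (hs : t ≤ s) :
    (Finset.univ.filter fun ef : Finset α × Finset α =>
      ef.1.card = r ∧ ef.2.card = s ∧ (ef.1 ∩ ef.2).card = t).card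
      ≤ Fintype.card α ^ (r + s - t) := by
  let U : Finset α := Finset.univ
  calc _ ≤ (U.powersetCard t ×ˢ U.powersetCard (r - t) ×ˢ U.powersetCard (s - t)).card := by
        refine Finset.card_le_card_of_injOn
          (fun ef => (ef.1 ∩ ef.2, ef.1 \ ef.2, ef.2 \ ef.1)) ?_ ?_
        · rintro ⟨e, f⟩ h
          simp only [Finset.coe_filter, Finset.mem_univ, true_and, Set.mem_ofPred_eq] at h
          obtain ⟨h1, h2, h3⟩ := h
          have h4 := Finset.card_inter_add_card_sdiff e f
          have h5 := Finset.card_inter_add_card_sdiff f e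
          rw [Finset.inter_comm] at h5
          simp only [Finset.mem_coe, Finset.mem_product, Finset.mem_powersetCard]
          refine ⟨⟨Finset.subset_univ _, h3⟩, ⟨Finset.subset_univ _, ?_⟩,
            Finset.subset_univ _, ?_⟩ <;> omega
        · rintro ⟨e, f⟩ - ⟨e', f'⟩ - h
          simp only [Prod.mk.injEq] at h ⊢
          obtain ⟨h1, h2, h3⟩ := h
          constructor
          · rw [← Finset.sdiff_union_inter e f, h1, h2, Finset.sdiff_union_inter]
          · rw [← Finset.sdiff_union_inter f e, h3, Finset.inter_comm f e, h1,
              Finset.inter_comm e' f', Finset.sdiff_union_inter]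
    _ ≤ Fintype.card α ^ t * (Fintype.card α ^ (r - t) * Fintype.card α ^ (s - t)) := by
        simp only [Finset.card_product, Finset.card_powersetCard, U, Finset.card_univ]
        gcongr <;> exact Nat.choose_le_pow _ _
    _ = _ := by
        rw [← pow_add, ← pow_add]
        congr 1
        omega

/-- Double counting of the pairs of edges with prescribed sizes and intersection size. -/
theorem sum_crossPairCount_le {G : Type*} [Group G] [Fintype G] [DecidableEq G] {d r s t : ℕ}
    (hr : t ≤ r) (hs : t ≤ s) (hrd : r ≤ d) (hsd : s ≤ d) :
    ∑ p : G × G, crossPairCount d p.1 p.2 r s t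
      ≤ Fintype.card G ^ (r + s - t) * ((2 * d + 1) ^ d) ^ 2 := by
  have h : ∑ p : G × G, crossPairCount d p.1 p.2 r s t =
      ∑ ef ∈ Finset.univ.filter fun ef : Finset G × Finset G =>
          ef.1.card = r ∧ ef.2.card = s ∧ (ef.1 ∩ ef.2).card = t,
        (Finset.univ.filter fun p : G × G => IsEdge d p.1 ef.1 ∧ IsEdge d p.2 ef.2).card := by
    simp only [crossPairCount, Finset.card_filter, Finset.sum_filter]
    rw [Finset.sum_comm]
    refine Finset.sum_congr rfl fun ef _ => ?_
    split_ifs with h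
    · obtain ⟨h1, h2, h3⟩ := h
      simp [h1, h2, h3]
    · refine Finset.sum_eq_zero fun p _ => if_neg ?_
      tauto
  rw [h]
  calc _ ≤ (Finset.univ.filter fun ef : Finset G × Finset G =>
          ef.1.card = r ∧ ef.2.card = s ∧ (ef.1 ∩ ef.2).card = t).card •
            ((2 * d + 1) ^ d) ^ 2 := by
        refine Finset.sum_le_card_nsmul _ _ _ fun ef hef => ?_
        obtain ⟨-, h1, h2, -⟩ := Finset.mem_filter.1 hef
        rw [← Finset.univ_product_univ, Finset.filter_product (IsEdge d · ef.1) (IsEdge d · ef.2),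
          Finset.card_product, sq]
        exact Nat.mul_le_mul (card_filter_isEdge_le (h1.trans_le hrd))
          (card_filter_isEdge_le (h2.trans_le hsd))
    _ ≤ _ := by
        rw [smul_eq_mul]
        exact Nat.mul_le_mul_right _ (card_pairs_inter_le hr hs)

/-- Markov's inequality for finite sums. -/
theorem card_filter_mul_le_sum {α : Type*} (S : Finset α) (f : α → ℝ) (hf : ∀ a ∈ S, 0 ≤ f a)
    (c : ℝ) : ((S.filter fun a => c ≤ f a).card : ℝ) * c ≤ ∑ a ∈ S, f a := by
  rw [← nsmul_eq_mul]
  exact (Finset.card_nsmul_le_sum _ _ _ fun a ha => (Finset.mem_filter.1 ha).2).trans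
    (Finset.sum_le_sum_of_subset_of_nonneg (Finset.filter_subset _ _) fun a ha _ => hf a ha)

theorem crossPairCount_comm {G : Type*} [Group G] [Fintype G] [DecidableEq G] (d : ℕ) (x y : G)
    (r s t : ℕ) : crossPairCount d x y r s t = crossPairCount d y x s r t := by
  refine Finset.card_equiv (Equiv.prodComm _ _) fun ef => ?_
  simp only [Finset.mem_filter, Finset.mem_univ, true_and, Equiv.prodComm_apply, Prod.fst_swap,
    Prod.snd_swap, Finset.inter_comm ef.2 ef.1]
  tauto

theorem depAdj.symm {G : Type*} [Group G] [Fintype G] [DecidableEq G] {d : ℕ} {δ : ℝ} {x y : G}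
    (h : depAdj d δ x y) : depAdj d δ y x := by
  obtain ⟨r, s, t, h1, h2, h3, h4, h5, h6⟩ := h
  refine ⟨s, r, t, h1, h4, h5, h2, h3, ?_⟩
  rwa [crossPairCount_comm, add_comm (s : ℝ)]

/-- A symmetric relation on `S` with degrees at most `D` has an independent set of size at least
`|S| / (1 + D)`. -/
theorem exists_independent_card_le {α : Type*} {R : α → α → Prop}
    (hR : ∀ x y, R x y → R y x) (S : Finset α) {D : ℝ}
    (hD : ∀ x ∈ S, ((S.filter (R x)).card : ℝ) ≤ D) :
    ∃ I ⊆ S, (∀ x ∈ I, ∀ y ∈ I, x ≠ y → ¬ R x y) ∧ (S.card : ℝ) ≤ I.card * (1 + D) := by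
  let P : Finset α → Prop := fun I => ∀ x ∈ I, ∀ y ∈ I, x ≠ y → ¬ R x y
  obtain ⟨I, hI, hmax⟩ := Finset.exists_max_image
    (S.powerset.filter P) Finset.card ⟨∅, by simp [P]⟩
  obtain ⟨hIS, hind⟩ := Finset.mem_filter.1 hI
  rw [Finset.mem_powerset] at hIS
  refine ⟨I, hIS, hind, ?_⟩
  have hcov : S ⊆ I.biUnion fun x => insert x (S.filter (R x)) := by
    intro y hy
    by_contra hcon
    simp only [Finset.mem_biUnion, Finset.mem_insert, Finset.mem_filter, hy, true_and, not_exists,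
      not_and, not_or] at hcon
    have hyI : y ∉ I := fun h => (hcon y h).1 rfl
    have := hmax (insert y I) (by
      simp only [Finset.mem_filter, Finset.mem_powerset, Finset.insert_subset_iff]
      refine ⟨⟨hy, hIS⟩, fun a ha b hb hab => ?_⟩
      rw [Finset.mem_insert] at ha hb
      rcases ha with rfl | ha <;> rcases hb with rfl | hb
      · exact absurd rfl hab
      · exact fun h => (hcon b hb).2 (hR _ _ h)
      · exact (hcon a ha).2
      · exact hind a ha b hb hab)
    rw [Finset.card_insert_of_notMem hyI] at this
    omega
  calc (S.card : ℝ) ≤ ∑ x ∈ I, ((insert x (S.filter (R x))).card : ℝ) := by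
        exact_mod_cast (Finset.card_le_card hcov).trans Finset.card_biUnion_le
    _ ≤ I.card • (1 + D) := by
        refine Finset.sum_le_card_nsmul _ _ _ fun x hx => ?_
        have h1 : ((insert x (S.filter (R x))).card : ℝ) ≤ (S.filter (R x)).card + 1 := by
          exact_mod_cast Finset.card_insert_le _ _
        linarith [hD x (hIS hx)]
    _ = _ := nsmul_eq_mul _ _

/-- Few vertices lie in more than `N ^ (k - 1 + δ)` edges of size `k`. -/
theorem card_edgeCount_large_le {G : Type*} [Group G] [Fintype G] (d : ℕ) (δ : ℝ) :
    ((Finset.univ.filter fun x : G => ∃ k, 1 ≤ k ∧ k ≤ d ∧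
      (Fintype.card G : ℝ) ^ ((k : ℝ) - 1 + δ) ≤ edgeCount d k x).card : ℝ)
      ≤ d * (((2 * d + 1) ^ d : ℕ) * (Fintype.card G : ℝ) ^ (1 - δ)) := by
  have hN : (0 : ℝ) < Fintype.card G := by exact_mod_cast Fintype.card_pos
  set N : ℝ := (Fintype.card G : ℝ) with hNdef
  have hsub : (Finset.univ.filter fun x : G => ∃ k, 1 ≤ k ∧ k ≤ d ∧
      N ^ ((k : ℝ) - 1 + δ) ≤ edgeCount d k x) ⊆ (Finset.Icc 1 d).biUnion fun k =>
        Finset.univ.filter fun x : G => N ^ ((k : ℝ) - 1 + δ) ≤ edgeCount d k x := by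
    intro x hx
    obtain ⟨-, k, h1, h2, h3⟩ := Finset.mem_filter.1 hx
    simp only [Finset.mem_biUnion, Finset.mem_filter, Finset.mem_univ, true_and, Finset.mem_Icc]
    exact ⟨k, ⟨h1, h2⟩, h3⟩
  calc _ ≤ ∑ k ∈ Finset.Icc 1 d, ((Finset.univ.filter fun x : G =>
          N ^ ((k : ℝ) - 1 + δ) ≤ edgeCount d k x).card : ℝ) := by
        exact_mod_cast (Finset.card_le_card hsub).trans Finset.card_biUnion_le
    _ ≤ (Finset.Icc 1 d).card • (((2 * d + 1) ^ d : ℕ) * N ^ (1 - δ)) := by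
        refine Finset.sum_le_card_nsmul _ _ _ fun k hk => ?_
        have h1 := card_filter_mul_le_sum (Finset.univ : Finset G) (fun x => (edgeCount d k x : ℝ))
          (fun _ _ => Nat.cast_nonneg _) (N ^ ((k : ℝ) - 1 + δ))
        have h2 : ∑ x : G, (edgeCount d k x : ℝ) ≤ N ^ k * ((2 * d + 1) ^ d : ℕ) := by
          rw [hNdef]
          exact_mod_cast sum_edgeCount_le (G := G) (Finset.mem_Icc.1 hk).2
        have hpos : 0 < N ^ ((k : ℝ) - 1 + δ) := Real.rpow_pos_of_pos hN _
        refine le_of_mul_le_mul_right (h1.trans (h2.trans_eq ?_)) hpos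
        rw [mul_assoc, ← Real.rpow_add hN, mul_comm, ← Real.rpow_natCast]
        congr 2
        ring
    _ = _ := by simp

/-- The `δ`-dependency relation has few pairs. -/
theorem card_depAdj_le {G : Type*} [Group G] [Fintype G] [DecidableEq G] (d : ℕ) (δ : ℝ) :
    ((Finset.univ.filter fun p : G × G => depAdj d δ p.1 p.2).card : ℝ)
      ≤ d ^ 3 * (((2 * d + 1) ^ d : ℕ) ^ 2 * (Fintype.card G : ℝ) ^ (1 + δ)) := by
  have hN : (0 : ℝ) < Fintype.card G := by exact_mod_cast Fintype.card_pos
  set N : ℝ := (Fintype.card G : ℝ) with hNdef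
  let T : Finset (ℕ × ℕ × ℕ) := Finset.Icc 1 d ×ˢ Finset.Icc 1 d ×ˢ Finset.Icc 1 d
  let B : ℕ × ℕ × ℕ → Finset (G × G) := fun q => Finset.univ.filter fun p =>
    (q.2.2 ≤ q.1 ∧ q.2.2 ≤ q.2.1) ∧
      N ^ ((q.1 : ℝ) + q.2.1 - q.2.2 - 1 - δ) ≤ crossPairCount d p.1 p.2 q.1 q.2.1 q.2.2
  have hsub : (Finset.univ.filter fun p : G × G => depAdj d δ p.1 p.2) ⊆ T.biUnion B := by
    intro p hp
    obtain ⟨-, r, s, t, h1, h2, h3, h4, h5, h6⟩ := Finset.mem_filter.1 hp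
    simp only [Finset.mem_biUnion, Finset.mem_filter, Finset.mem_univ, true_and, Finset.mem_Icc,
      Finset.mem_product, T, B]
    exact ⟨(r, s, t), ⟨⟨h1.trans h2, h3⟩, ⟨h1.trans h4, h5⟩, h1, h2.trans h3⟩, ⟨h2, h4⟩, h6⟩
  calc _ ≤ ∑ q ∈ T, ((B q).card : ℝ) := by
        exact_mod_cast (Finset.card_le_card hsub).trans Finset.card_biUnion_le
    _ ≤ T.card • (((2 * d + 1) ^ d : ℕ) ^ 2 * N ^ (1 + δ)) := by
        refine Finset.sum_le_card_nsmul _ _ _ ?_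
        rintro ⟨r, s, t⟩ hq
        simp only [T, Finset.mem_product, Finset.mem_Icc] at hq
        by_cases ht : t ≤ r ∧ t ≤ s
        · have h1 := card_filter_mul_le_sum (Finset.univ : Finset (G × G))
            (fun p => (crossPairCount d p.1 p.2 r s t : ℝ))
            (fun _ _ => Nat.cast_nonneg _) (N ^ ((r : ℝ) + s - t - 1 - δ))
          have h2 : ∑ p : G × G, (crossPairCount d p.1 p.2 r s t : ℝ)
              ≤ N ^ (r + s - t) * ((2 * d + 1) ^ d : ℕ) ^ 2 := by
            rw [hNdef]
            exact_mod_cast sum_crossPairCount_le (G := G) ht.1 ht.2 hq.1.2 hq.2.1.2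
          have hpos : 0 < N ^ ((r : ℝ) + s - t - 1 - δ) := Real.rpow_pos_of_pos hN _
          simp only [B, ht, and_self, true_and]
          refine le_of_mul_le_mul_right (h1.trans (h2.trans_eq ?_)) hpos
          rw [mul_assoc, ← Real.rpow_add hN, mul_comm, ← Real.rpow_natCast N,
            Nat.cast_sub (by omega), Nat.cast_add]
          congr 2
          ring
        · have : B (r, s, t) = ∅ := Finset.filter_eq_empty_iff.2 fun p _ h => ht h.1
          rw [this, Finset.card_empty, Nat.cast_zero]
          positivity
    _ = _ := by
        simp only [T, Finset.card_product, Nat.card_Icc, nsmul_eq_mul]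
        push_cast [Nat.add_sub_cancel]
        ring

/-- All but few vertices have small degree in the `δ`-dependency graph. -/
theorem card_degree_large_mul_le {α : Type*} [Fintype α] (R : α → α → Prop) (D : ℝ) :
    ((Finset.univ.filter fun x => D ≤ (Finset.univ.filter (R x)).card).card : ℝ) * D
      ≤ (Finset.univ.filter fun p : α × α => R p.1 p.2).card := by
  refine (card_filter_mul_le_sum Finset.univ (fun x => ((Finset.univ.filter (R x)).card : ℝ))
    (fun _ _ => Nat.cast_nonneg _) D).trans_eq ?_
  simp only [Finset.card_filter]
  push_cast
  rw [Fintype.sum_prod_type]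

theorem stmt17 (G : Type*) [Group G] [Fintype G] [DecidableEq G] (d : ℕ) (hd : 2 ≤ d)
    (δ : ℝ) (hδ : 0 < δ)
    (hNδ : (4 : ℝ) ^ (d + 2) * (d : ℝ) ^ (d + 3) ≤ (Fintype.card G : ℝ) ^ δ) :
    ∃ I : Finset G, (1 : G) ∉ I ∧
      (Fintype.card G : ℝ) ^ (1 - 3 * δ) ≤ (I.card : ℝ) ∧
      (∀ x ∈ I, ∀ y ∈ I, x ≠ y → ¬ depAdj d δ x y) ∧
      (∀ x ∈ I, ∀ k : ℕ, 1 ≤ k → k ≤ d →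
        (edgeCount d k x : ℝ) ≤ (Fintype.card G : ℝ) ^ ((k : ℝ) - 1 + δ)) := by
  have hN : (0 : ℝ) < Fintype.card G := by exact_mod_cast Fintype.card_pos
  have hB1 := card_edgeCount_large_le (G := G) d δ
  have hB2 := card_degree_large_mul_le (depAdj (G := G) d δ)
    (8 * (d ^ 3 * ((2 * d + 1) ^ d : ℕ) ^ 2 * (Fintype.card G : ℝ) ^ δ))
  have hP := card_depAdj_le (G := G) d δ
  set N : ℝ := (Fintype.card G : ℝ) with hNdef
  set C : ℝ := (((2 * d + 1) ^ d : ℕ) : ℝ) with hCdef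
  have hd2 : (2 : ℝ) ≤ d := by exact_mod_cast hd
  have hC1 : (1 : ℝ) ≤ C := by
    rw [hCdef]; exact_mod_cast Nat.one_le_pow _ _ (by omega)
  have hC : C ≤ 4 ^ d * (d : ℝ) ^ d := by
    rw [hCdef, ← mul_pow]
    push_cast
    gcongr
    linarith
  set A : ℝ := N ^ δ with hA
  have hd1 : (1 : ℝ) ≤ d := by linarith
  have hdC : 16 * d ^ 3 * C ≤ A := by
    refine le_trans ?_ hNδ
    calc 16 * (d : ℝ) ^ 3 * C ≤ 16 * d ^ 3 * (4 ^ d * (d : ℝ) ^ d) := by gcongr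
      _ = _ := by ring
  have hd3 : (d : ℝ) ≤ d ^ 3 := le_self_pow₀ hd1 (by norm_num)
  have hd31 : (1 : ℝ) ≤ d ^ 3 := one_le_pow₀ hd1
  have hApos : 0 < A := Real.rpow_pos_of_pos hN _
  have hNsub : N ^ (1 - δ) = N / A := by rw [Real.rpow_sub hN, Real.rpow_one]
  have hNadd : N ^ (1 + δ) = N * A := by rw [Real.rpow_add hN, Real.rpow_one]
  have hA16 : 16 ≤ A := by nlinarith [mul_le_mul hd31 hC1 (by norm_num) (by positivity)]
  have hN2 : 2 ≤ N := by
    by_contra hlt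
    have hlt' : Fintype.card G < 2 := by
      rw [hNdef] at hlt
      exact_mod_cast not_le.1 hlt
    have hN1 : N ≤ 1 := by
      rw [hNdef]; exact_mod_cast Nat.lt_succ_iff.1 hlt'
    linarith [Real.rpow_le_one hN.le hN1 hδ.le]
  set M : ℝ := d ^ 3 * C ^ 2 with hM
  have hM1 : 1 ≤ M := one_le_mul_of_one_le_of_one_le hd31 (one_le_pow₀ hC1)
  set B1 := Finset.univ.filter fun x : G => ∃ k, 1 ≤ k ∧ k ≤ d ∧
    N ^ ((k : ℝ) - 1 + δ) ≤ edgeCount d k x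
  set B2 := Finset.univ.filter fun x : G =>
    8 * (M * A) ≤ (Finset.univ.filter (depAdj d δ x)).card
  have hb1 : (B1.card : ℝ) ≤ N / 16 := by
    rw [hNsub] at hB1
    refine hB1.trans ?_
    rw [← mul_assoc, mul_div_assoc', div_le_div_iff₀ hApos (by norm_num)]
    have h16 : 16 * (d * C) ≤ A := by nlinarith [mul_le_mul_of_nonneg_right hd3 (by linarith : 0 ≤ C)]
    nlinarith
  have hb2 : (B2.card : ℝ) ≤ N / 8 := by
    refine le_of_mul_le_mul_right (hB2.trans (hP.trans_eq ?_)) (by positivity : 0 < 8 * (M * A))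
    rw [hNadd, hM]
    ring
  obtain ⟨I, hIS, hind, hcard⟩ := exists_independent_card_le (R := depAdj d δ)
    (fun _ _ => depAdj.symm) (Finset.univ \ insert 1 (B1 ∪ B2)) (D := 8 * (M * A)) (by
      intro x hx
      have hx2 : x ∉ B2 := fun h => (Finset.mem_sdiff.1 hx).2
        (Finset.mem_insert_of_mem (Finset.mem_union_right _ h))
      simp only [B2, Finset.mem_filter, Finset.mem_univ, true_and, not_le] at hx2
      refine le_trans ?_ hx2.le
      exact_mod_cast Finset.card_le_card (Finset.filter_subset_filter _ (Finset.subset_univ _)))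
  have hS : N / 4 ≤ ((Finset.univ \ insert 1 (B1 ∪ B2)).card : ℝ) := by
    have h1 := Finset.card_sdiff_add_card_eq_card (Finset.subset_univ (insert 1 (B1 ∪ B2)))
    have h2 := (Finset.card_insert_le 1 (B1 ∪ B2)).trans
      (Nat.add_le_add_right (Finset.card_union_le B1 B2) 1)
    rw [Finset.card_univ] at h1
    have h1' : ((Finset.univ \ insert 1 (B1 ∪ B2)).card : ℝ) + (insert 1 (B1 ∪ B2)).card = N := by
      rw [hNdef, ← h1]; push_cast; rfl
    have h2' : ((insert 1 (B1 ∪ B2)).card : ℝ) ≤ B1.card + B2.card + 1 := by exact_mod_cast h2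
    linarith
  refine ⟨I, fun h => ?_, ?_, hind, fun x hx k hk hkd => ?_⟩
  · exact (Finset.mem_sdiff.1 (hIS h)).2 (Finset.mem_insert_self _ _)
  · have hMA : 1 ≤ M * A := one_le_mul_of_one_le_of_one_le hM1 (by linarith)
    have hMA2 : 256 * M ≤ A ^ 2 := by
      calc 256 * M = 256 * (d ^ 3 * C ^ 2) * 1 := by rw [hM, mul_one]
        _ ≤ 256 * (d ^ 3 * C ^ 2) * d ^ 3 := by gcongr
        _ = (16 * d ^ 3 * C) ^ 2 := by ring
        _ ≤ A ^ 2 := by gcongr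
    have hA3 : N ^ (1 - 3 * δ) = N / A ^ 3 := by
      rw [Real.rpow_sub hN, Real.rpow_one, hA, ← Real.rpow_natCast, ← Real.rpow_mul hN.le,
        mul_comm 3 δ]
      norm_num
    rw [hA3, div_le_iff₀ (by positivity)]
    calc N ≤ 4 * (I.card * (1 + 8 * (M * A))) := by linarith
      _ ≤ 4 * (I.card * (64 * (M * A))) := by gcongr; linarith
      _ = I.card * (256 * M * A) := by ring
      _ ≤ I.card * (A ^ 2 * A) := by gcongr
      _ = I.card * A ^ 3 := by ring
  · by_contra! hlt
    refine (Finset.mem_sdiff.1 (hIS hx)).2 (Finset.mem_insert_of_mem (Finset.mem_union_left _ ?_))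
    exact Finset.mem_filter.2 ⟨Finset.mem_univ _, k, hk, hkd, hlt.le⟩
end
end

section
/- Let G be a finite group of order N, let d ≥ 2 be an integer, and let δ > 0 satisfy N^δ ≥ 2^d·d^(d+3). Let x, y ∈ G∖{1} and suppose that for every integer 1 ≤ k ≤ d, each of the diameter-d hypergraphs Γ_x and Γ_y has at most N^(k−1+δ) edges of size k. Then for all integers r, s, t with 1 ≤ t ≤ r ≤ d, t ≤ s ≤ d, and r + s − t ≥ d + 1, the number of pairs (e, f), where e is an r-edge of Γ_x, f is an s-edge of Γ_y, and |e ∩ f| = t, is at most N^(r+s−t−2+2δ). -/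
open scoped Classical

noncomputable section

/-- Changing a single factor of a product in a group changes the product. -/
theorem eq_of_prod_ofFn_eq_s18 {G : Type*} [Group G] :
    ∀ {n : ℕ} {u v : Fin n → G} (i : Fin n), (∀ j, j ≠ i → u j = v j) →
      (List.ofFn u).prod = (List.ofFn v).prod → u i = v i := by
  intro n
  induction n with
  | zero => intro u v i; exact i.elim0
  | succ n ih =>
    intro u v i huv hprod
    simp only [List.ofFn_succ, List.prod_cons] at hprod
    induction i using Fin.cases with
    | zero =>
      have htail : (fun j : Fin n => u j.succ) = fun j => v j.succ :=
        funext fun j => huv _ (Fin.succ_ne_zero j)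
      rw [htail] at hprod
      exact mul_right_cancel hprod
    | succ i =>
      rw [huv 0 (Fin.succ_ne_zero i).symm] at hprod
      exact ih (u := fun j => u j.succ) (v := fun j => v j.succ) i
        (fun j hj => huv _ fun h => hj (Fin.succ_injective _ h)) (mul_left_cancel hprod)

/-- The number of words of length `n` with exactly `k` distinct letters outside `e`. -/
theorem card_words_le_s18 {G : Type*} [Fintype G] [DecidableEq G] (e : Finset G) (n k : ℕ) :
    (Finset.univ.filter fun h : Fin n → G => (Finset.univ.image h \ e).card = k).card ≤
      Fintype.card G ^ k * (n.choose k * (e.card + k) ^ (n - k)) := by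
  induction n generalizing k with
  | zero =>
    rcases k with _ | k
    · simp
    · simp
  | succ n ih =>
    have himage : ∀ h : Fin (n + 1) → G,
        Finset.univ.image h = insert (h 0) (Finset.univ.image (Fin.tail h)) := by
      intro h
      ext g
      simp [Fin.exists_fin_succ, Fin.tail, eq_comm]
    set W : ℕ → Finset (Fin n → G) := fun k =>
      Finset.univ.filter fun h : Fin n → G => (Finset.univ.image h \ e).card = k with hW
    have hold : ((W k).sigma fun h => e ∪ (Finset.univ.image h \ e)).card ≤
        (W k).card * (e.card + k) := by
      rw [Finset.card_sigma]
      refine Finset.sum_le_card_nsmul _ _ _ fun h hh => ?_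
      refine (Finset.card_union_le _ _).trans ?_
      rw [(Finset.mem_filter.1 hh).2]
    have hinj : Function.Injective fun h : Fin (n + 1) → G =>
        (⟨Fin.tail h, h 0⟩ : (_ : Fin n → G) × G) := by
      intro h h' hh
      simp only [Sigma.mk.injEq, heq_eq_eq] at hh
      rw [← Fin.cons_self_tail h, ← Fin.cons_self_tail h', hh.1, hh.2]
    rcases k with _ | k
    · have hmain : (Finset.univ.filter fun h : Fin (n + 1) → G =>
          (Finset.univ.image h \ e).card = 0).card ≤ (W 0).card * (e.card + 0) := by
        refine le_trans (Finset.card_le_card_of_injOn _ ?_ hinj.injOn) hold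
        intro h hh
        have hh := (Finset.mem_filter.1 (Finset.mem_coe.1 hh)).2
        rw [himage, Finset.card_eq_zero, Finset.sdiff_eq_empty_iff_subset,
          Finset.insert_subset_iff] at hh
        simpa [hW, hh.1, Finset.sdiff_eq_empty_iff_subset] using Or.inl hh.2
      refine hmain.trans ((Nat.mul_le_mul_right _ (ih 0)).trans (le_of_eq ?_))
      simp [pow_succ]
    · have hmain : (Finset.univ.filter fun h : Fin (n + 1) → G =>
          (Finset.univ.image h \ e).card = k + 1).card ≤
            (W (k + 1)).card * (e.card + (k + 1)) + (W k).card * Fintype.card G := by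
        have hnew : ((W k).sigma fun _ => (Finset.univ : Finset G)).card =
            (W k).card * Fintype.card G := by
          simp [Finset.card_sigma]
        rw [← hnew]
        refine le_trans (Finset.card_le_card_of_injOn _ ?_ hinj.injOn)
          ((Finset.card_union_le _ _).trans (Nat.add_le_add_right hold _))
        intro h hh
        have hh := (Finset.mem_filter.1 (Finset.mem_coe.1 hh)).2
        rw [himage] at hh
        by_cases h0 : h 0 ∈ e ∪ (Finset.univ.image (Fin.tail h) \ e)
        · refine Finset.mem_coe.2 (Finset.mem_union_left _ (Finset.mem_sigma.2 ⟨?_, h0⟩))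
          refine Finset.mem_filter.2 ⟨Finset.mem_univ _, ?_⟩
          rw [← hh]
          congr 1
          ext g
          simp only [Finset.mem_union, Finset.mem_sdiff, Finset.mem_insert] at h0 ⊢
          grind
        · refine Finset.mem_coe.2 (Finset.mem_union_right _
            (Finset.mem_sigma.2 ⟨?_, Finset.mem_univ _⟩))
          refine Finset.mem_filter.2 ⟨Finset.mem_univ _, ?_⟩
          simp only [Finset.mem_union, not_or] at h0
          rw [Finset.insert_sdiff_of_notMem _ h0.1, Finset.card_insert_of_notMem h0.2] at hh
          exact Nat.succ_injective hh
      refine hmain.trans ?_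
      refine (Nat.add_le_add (Nat.mul_le_mul_right _ (ih (k + 1)))
        (Nat.mul_le_mul_right _ (ih k))).trans ?_
      rcases lt_or_ge n (k + 1) with hn | hn
      · rw [Nat.choose_eq_zero_of_lt hn, Nat.choose_succ_succ, Nat.choose_eq_zero_of_lt hn]
        have h1 : n - k = 0 := by omega
        have h2 : n + 1 - (k + 1) = 0 := by omega
        rw [h1, h2]
        apply le_of_eq
        ring
      · have h1 : n + 1 - (k + 1) = n - (k + 1) + 1 := by omega
        have h2 : n - k = n - (k + 1) + 1 := by omega
        rw [h1, h2, Nat.choose_succ_succ]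
        have h3 : (e.card + k) ^ (n - (k + 1) + 1) ≤ (e.card + (k + 1)) ^ (n - (k + 1) + 1) :=
          Nat.pow_le_pow_left (by omega) _
        calc _ = Fintype.card G ^ (k + 1) *
              (n.choose (k + 1) * (e.card + (k + 1)) ^ (n - (k + 1) + 1) +
                n.choose k * (e.card + k) ^ (n - (k + 1) + 1)) := by ring
          _ ≤ Fintype.card G ^ (k + 1) *
              (n.choose (k + 1) * (e.card + (k + 1)) ^ (n - (k + 1) + 1) +
                n.choose k * (e.card + (k + 1)) ^ (n - (k + 1) + 1)) := by gcongr
          _ = _ := by rw [Nat.succ_eq_add_one]; ring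

theorem exp_natCast_le_four_mul_factorial (k : ℕ) :
    Real.exp k ≤ 4 * (k.factorial : ℝ) := by
  have he := Real.exp_one_lt_d9
  have hpos := Real.exp_pos 1
  induction k with
  | zero => norm_num
  | succ k ih =>
    rcases lt_or_ge k 2 with hk | hk
    · interval_cases k
      · norm_num
        linarith
      · have h2 : Real.exp ((1 + 1 : ℕ) : ℝ) = Real.exp 1 * Real.exp 1 := by
          rw [← Real.exp_add]; norm_num
        rw [h2]
        norm_num
        nlinarith
    · rw [Nat.factorial_succ]
      push_cast
      rw [Real.exp_add, mul_comm]
      have hk' : (2 : ℝ) ≤ k := by exact_mod_cast hk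
      have : Real.exp 1 ≤ (k : ℝ) + 1 := by linarith
      calc Real.exp 1 * Real.exp k ≤ ((k : ℝ) + 1) * (4 * (k.factorial : ℝ)) := by gcongr
        _ = _ := by ring

theorem choose_mul_add_pow_le {d n r : ℕ} (hd : 2 ≤ d) (hn : n < d) (hr : r ≤ d) (k : ℕ) :
    n.choose k * (r + k) ^ (n - k) ≤ d ^ (d + 1) := by
  rcases lt_or_ge n k with hk | hk
  · simp [Nat.choose_eq_zero_of_lt hk]
  have hd0 : (0 : ℝ) < d := by exact_mod_cast (by omega : 0 < d)
  have hd2 : (2 : ℝ) ≤ d := by exact_mod_cast hd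
  have hd1 : (1 : ℝ) ≤ d := by linarith
  have hrd : (r : ℝ) ≤ d := by exact_mod_cast hr
  have hfac : (0 : ℝ) < k.factorial := by exact_mod_cast k.factorial_pos
  have hchoose : (n.choose k : ℝ) ≤ (d : ℝ) ^ k / k.factorial := by
    refine (Nat.choose_le_pow_div (α := ℝ) k n).trans ?_
    have : (n : ℝ) ≤ d := by exact_mod_cast hn.le
    gcongr
  have hpow : ((r : ℝ) + k) ^ (n - k) ≤ (d : ℝ) ^ (n - k) * Real.exp k := by
    have h1 : (r : ℝ) + k ≤ d * Real.exp (k / d) := by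
      have := Real.add_one_le_exp ((k : ℝ) / d)
      calc (r : ℝ) + k ≤ d + k := by linarith
        _ = d * (k / d + 1) := by field_simp; ring
        _ ≤ _ := by gcongr
    calc ((r : ℝ) + k) ^ (n - k) ≤ (d * Real.exp (k / d)) ^ (n - k) := by gcongr
      _ = (d : ℝ) ^ (n - k) * Real.exp ((n - k : ℕ) * (k / d)) := by
        rw [mul_pow, Real.exp_nat_mul]
      _ ≤ _ := by
        gcongr
        have : ((n - k : ℕ) : ℝ) ≤ d := by exact_mod_cast (by omega : n - k ≤ d)
        calc ((n - k : ℕ) : ℝ) * (k / d) ≤ d * (k / d) := by gcongr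
          _ = k := by field_simp
  have hmain : (n.choose k : ℝ) * ((r : ℝ) + k) ^ (n - k) ≤ (d : ℝ) ^ (d + 1) := by
    calc (n.choose k : ℝ) * ((r : ℝ) + k) ^ (n - k)
        ≤ (d : ℝ) ^ k / k.factorial * ((d : ℝ) ^ (n - k) * (4 * k.factorial)) := by
          gcongr
          refine hpow.trans ?_
          gcongr
          exact exp_natCast_le_four_mul_factorial k
      _ = (d : ℝ) ^ (k + (n - k)) * 4 := by
          rw [pow_add]; field_simp
      _ ≤ (d : ℝ) ^ (d - 1) * (d : ℝ) ^ 2 := by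
          have : (4 : ℝ) ≤ (d : ℝ) ^ 2 := by nlinarith
          gcongr
          omega
      _ = (d : ℝ) ^ (d + 1) := by
          rw [← pow_add]; congr 1; omega
  exact_mod_cast hmain

/-- A short word whose set of letters has many elements outside `e` contains some letter
outside `e` exactly once. -/
theorem exists_letter_once {G : Type*} [DecidableEq G] {l : ℕ} (h : Fin l → G)
    (e : Finset G)
    (hl : l < (e ∩ Finset.univ.image h).card + 2 * (Finset.univ.image h \ e).card) :
    ∃ i, h i ∉ e ∧ ∀ j, j ≠ i → h j ≠ h i := by
  by_contra! hcon
  have hfib : l = ∑ g ∈ Finset.univ.image h,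
      (Finset.univ.filter fun i => h i = g).card := by
    simpa using Finset.card_eq_sum_card_image h (Finset.univ : Finset (Fin l))
  have hunion : e ∩ Finset.univ.image h ∪ Finset.univ.image h \ e = Finset.univ.image h := by
    ext g; simp only [Finset.mem_union, Finset.mem_inter, Finset.mem_sdiff]; tauto
  have hdisj : Disjoint (e ∩ Finset.univ.image h) (Finset.univ.image h \ e) :=
    Finset.disjoint_left.2 fun g hg hg' =>
      (Finset.mem_sdiff.1 hg').2 (Finset.mem_inter.1 hg).1
  rw [← hunion, Finset.sum_union hdisj] at hfib
  have h1 : (e ∩ Finset.univ.image h).card • 1 ≤ ∑ g ∈ e ∩ Finset.univ.image h,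
      (Finset.univ.filter fun i => h i = g).card := by
    refine Finset.card_nsmul_le_sum _ _ _ fun g hg => ?_
    obtain ⟨i, -, hi⟩ := Finset.mem_image.1 (Finset.mem_inter.1 hg).2
    exact Finset.card_pos.2 ⟨i, by simp [hi]⟩
  have h2 : (Finset.univ.image h \ e).card • 2 ≤ ∑ g ∈ Finset.univ.image h \ e,
      (Finset.univ.filter fun i => h i = g).card := by
    refine Finset.card_nsmul_le_sum _ _ _ fun g hg => ?_
    obtain ⟨i, -, hi⟩ := Finset.mem_image.1 (Finset.mem_sdiff.1 hg).1
    obtain ⟨j, hji, hj⟩ := hcon i (hi ▸ (Finset.mem_sdiff.1 hg).2)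
    exact Finset.one_lt_card.2 ⟨i, by simp [hi], j, by simp [hj, hi], hji.symm⟩
  simp only [smul_eq_mul] at h1 h2
  omega

/-- The number of `s`-edges of `Γ_y` that meet a fixed set `e` in exactly `t` elements. -/
theorem card_edges_meeting_le {G : Type*} [Group G] [Fintype G] [DecidableEq G] {d : ℕ}
    (hd : 2 ≤ d) (y : G) {e : Finset G} (he : e.card ≤ d) {s t : ℕ} (hst : d + t < 2 * s)
    (hts : t ≤ s) :
    (Finset.univ.filter fun f : Finset G =>
      f.card = s ∧ IsEdge d y f ∧ (e ∩ f).card = t).card ≤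
        2 ^ d * d ^ (d + 3) * Fintype.card G ^ (s - t - 1) := by
  set D : Finset ((n : ℕ) × ((Fin (n + 1) → ℤ) × Fin (n + 1) × (Fin n → G))) :=
    (Finset.range d).sigma fun n =>
      Fintype.piFinset (fun _ => ({1, -1} : Finset ℤ)) ×ˢ (Finset.univ ×ˢ
        Finset.univ.filter fun h : Fin n → G =>
          (Finset.univ.image h \ e).card = s - t - 1) with hD
  have hDcard : D.card ≤ 2 ^ d * d ^ (d + 3) * Fintype.card G ^ (s - t - 1) := by
    rw [hD, Finset.card_sigma]
    refine (Finset.sum_le_card_nsmul _ _ (2 ^ d * (d *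
      (Fintype.card G ^ (s - t - 1) * d ^ (d + 1)))) fun n hn => ?_).trans (le_of_eq ?_)
    · have hn := Finset.mem_range.1 hn
      rw [Finset.card_product, Finset.card_product, Fintype.card_piFinset_const,
        Finset.card_univ, Fintype.card_fin, Finset.card_pair (by norm_num)]
      refine Nat.mul_le_mul (Nat.pow_le_pow_right (by norm_num) hn)
        (Nat.mul_le_mul hn ((card_words_le_s18 e n _).trans (Nat.mul_le_mul_left _ ?_)))
      exact choose_mul_add_pow_le hd hn he _
    · rw [Finset.card_range, smul_eq_mul]
      ring
  have hcode : ∀ f : Finset G, f.card = s ∧ IsEdge d y f ∧ (e ∩ f).card = t →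
      ∃ (n : ℕ) (a : Fin (n + 1) → ℤ) (i : Fin (n + 1)) (h : Fin (n + 1) → G),
        (⟨n, a, i, h ∘ i.succAbove⟩ :
          (n : ℕ) × ((Fin (n + 1) → ℤ) × Fin (n + 1) × (Fin n → G))) ∈ D ∧
        Finset.univ.image h = f ∧ (List.ofFn fun j => h j ^ a j).prod = y := by
    rintro f ⟨hfs, ⟨-, l, -, hld, h, a, hmem, hsurj, ha, hprod⟩, hft⟩
    have himage : Finset.univ.image h = f := by
      ext g
      simp only [Finset.mem_image, Finset.mem_univ, true_and]
      exact ⟨fun ⟨i, hi⟩ => hi ▸ hmem i, hsurj g⟩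
    have hsdiff : (f \ e).card = s - t := by
      rw [Finset.card_sdiff, hft, hfs]
    obtain ⟨i, hie, hi⟩ := exists_letter_once h e (by rw [himage, hft, hsdiff]; omega)
    obtain ⟨n, rfl⟩ : ∃ n, l = n + 1 := ⟨l - 1, by have := i.pos; omega⟩
    refine ⟨n, a, i, h, ?_, himage, hprod⟩
    have hins : f = insert (h i) (Finset.univ.image (h ∘ i.succAbove)) := by
      rw [← himage]
      ext g
      simp [Fin.exists_iff_succAbove (p := i), eq_comm]
    have hnot : h i ∉ Finset.univ.image (h ∘ i.succAbove) \ e := by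
      simp only [Finset.mem_sdiff, Finset.mem_image, Finset.mem_univ, true_and, not_and]
      rintro ⟨j, hj⟩
      exact absurd hj (hi _ (Fin.succAbove_ne i j))
    rw [hins, Finset.insert_sdiff_of_notMem _ hie, Finset.card_insert_of_notMem hnot] at hsdiff
    simp only [hD, Finset.mem_sigma, Finset.mem_range, Finset.mem_product, Finset.mem_univ,
      Fintype.mem_piFinset, Finset.mem_insert, Finset.mem_singleton, Finset.mem_filter, true_and]
    exact ⟨hld, ha, by omega⟩
  choose! n a i h hmem himage hprod using hcode
  refine le_trans (Finset.card_le_card_of_injOn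
    (fun f => (⟨n f, a f, i f, h f ∘ (i f).succAbove⟩ :
      (n : ℕ) × ((Fin (n + 1) → ℤ) × Fin (n + 1) × (Fin n → G)))) ?_ ?_) hDcard
  · intro f hf
    exact hmem f (Finset.mem_filter.1 (Finset.mem_coe.1 hf)).2
  · intro f hf f' hf' hff'
    have hf := (Finset.mem_filter.1 (Finset.mem_coe.1 hf)).2
    have hf' := (Finset.mem_filter.1 (Finset.mem_coe.1 hf')).2
    have hm := hmem f hf
    have hI := himage f hf
    have hP := hprod f hf
    have hI' := himage f' hf'
    have hP' := hprod f' hf'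
    dsimp only at hff'
    clear hf hf'
    generalize n f = m, a f = b, i f = p, h f = u at *
    generalize n f' = m', a f' = b', i f' = p', h f' = u' at *
    obtain ⟨rfl, hdata⟩ := Sigma.mk.inj_iff.1 hff'
    obtain ⟨rfl, hrest⟩ := Prod.mk_inj.1 (eq_of_heq hdata)
    obtain ⟨rfl, huu⟩ := Prod.mk_inj.1 hrest
    have hoff : ∀ j, j ≠ p → u j = u' j := by
      intro j hj
      obtain ⟨j, rfl⟩ := Fin.exists_succAbove_eq hj
      exact congrFun huu j
    have hp := eq_of_prod_ofFn_eq_s18 (u := fun j => u j ^ b j) (v := fun j => u' j ^ b j) p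
      (fun j hj => by rw [hoff j hj]) (hP.trans hP'.symm)
    have hb : b p = 1 ∨ b p = -1 := by
      simp only [hD, Finset.mem_sigma, Finset.mem_product, Fintype.mem_piFinset,
        Finset.mem_insert, Finset.mem_singleton] at hm
      exact hm.2.1 p
    have hup : u p = u' p := by
      rcases hb with hb | hb <;> simpa [hb] using hp
    have : u = u' := funext fun j => by
      by_cases hj : j = p
      · rw [hj, hup]
      · exact hoff j hj
    rw [← hI, ← hI', this]

theorem crossPairCount_le {G : Type*} [Group G] [Fintype G] [DecidableEq G] {d : ℕ}
    (hd : 2 ≤ d) (x y : G) {r s t : ℕ} (hrd : r ≤ d) (hts : t ≤ s) (hst : d + t < 2 * s) :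
    crossPairCount d x y r s t ≤
      edgeCount d r x * (2 ^ d * d ^ (d + 3) * Fintype.card G ^ (s - t - 1)) := by
  set E := Finset.univ.filter fun E : Finset G => E.card = r ∧ IsEdge d x E with hE
  set F : Finset G → Finset (Finset G) := fun e => Finset.univ.filter fun f : Finset G =>
    f.card = s ∧ IsEdge d y f ∧ (e ∩ f).card = t with hF
  have hle : crossPairCount d x y r s t ≤ (E.sigma F).card := by
    refine Finset.card_le_card_of_injOn (fun p => ⟨p.1, p.2⟩) ?_ ?_
    · intro p hp
      have hp := (Finset.mem_filter.1 (Finset.mem_coe.1 hp)).2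
      simp only [hE, hF, Finset.coe_sigma, Set.mem_sigma_iff, Finset.mem_coe,
        Finset.mem_filter, Finset.mem_univ, true_and]
      tauto
    · intro p _ q _ hpq
      simp only [Sigma.mk.injEq, heq_eq_eq] at hpq
      exact Prod.ext hpq.1 hpq.2
  refine hle.trans ?_
  rw [Finset.card_sigma]
  refine Finset.sum_le_card_nsmul _ _ _ fun e he => ?_
  exact card_edges_meeting_le hd y ((Finset.mem_filter.1 he).2.1.trans_le hrd) hst hts

theorem crossPairCount_le_rpow {G : Type*} [Group G] [Fintype G] [DecidableEq G] {d : ℕ}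
    (hd : 2 ≤ d) {δ : ℝ}
    (hNδ : (2 : ℝ) ^ d * (d : ℝ) ^ (d + 3) ≤ (Fintype.card G : ℝ) ^ δ)
    (x y : G) {r s t : ℕ}
    (hxe : (edgeCount d r x : ℝ) ≤ (Fintype.card G : ℝ) ^ ((r : ℝ) - 1 + δ))
    (hrd : r ≤ d) (hsd : s ≤ d) (hts : t ≤ s) (hst : d + t < 2 * s) :
    (crossPairCount d x y r s t : ℝ) ≤
      (Fintype.card G : ℝ) ^ ((r : ℝ) + (s : ℝ) - (t : ℝ) - 2 + 2 * δ) := by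
  have hN : (0 : ℝ) < Fintype.card G := by exact_mod_cast Fintype.card_pos
  have hcast : ((s - t - 1 : ℕ) : ℝ) = (s : ℝ) - t - 1 := by
    rw [Nat.sub_sub, Nat.cast_sub (by omega)]
    push_cast
    ring
  calc (crossPairCount d x y r s t : ℝ)
      ≤ edgeCount d r x * ((2 : ℝ) ^ d * (d : ℝ) ^ (d + 3) *
          (Fintype.card G : ℝ) ^ (s - t - 1)) := by
        exact_mod_cast crossPairCount_le hd x y hrd hts hst
    _ ≤ (Fintype.card G : ℝ) ^ ((r : ℝ) - 1 + δ) *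
          ((Fintype.card G : ℝ) ^ δ * (Fintype.card G : ℝ) ^ (s - t - 1)) := by gcongr
    _ = _ := by
        rw [← Real.rpow_natCast (Fintype.card G : ℝ) (s - t - 1), hcast, ← Real.rpow_add hN,
          ← Real.rpow_add hN]
        congr 1
        ring


theorem stmt18 (G : Type*) [Group G] [Fintype G] [DecidableEq G] (d : ℕ) (hd : 2 ≤ d)
    (δ : ℝ) (hδ : 0 < δ)
    (hNδ : (2 : ℝ) ^ d * (d : ℝ) ^ (d + 3) ≤ (Fintype.card G : ℝ) ^ δ)
    (x y : G) (hx : x ≠ 1) (hy : y ≠ 1)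
    (hxe : ∀ k : ℕ, 1 ≤ k → k ≤ d →
      (edgeCount d k x : ℝ) ≤ (Fintype.card G : ℝ) ^ ((k : ℝ) - 1 + δ))
    (hye : ∀ k : ℕ, 1 ≤ k → k ≤ d →
      (edgeCount d k y : ℝ) ≤ (Fintype.card G : ℝ) ^ ((k : ℝ) - 1 + δ))
    (r s t : ℕ) (ht1 : 1 ≤ t) (htr : t ≤ r) (hrd : r ≤ d) (hts : t ≤ s) (hsd : s ≤ d)
    (hrst : d + 1 ≤ r + s - t) :
    (crossPairCount d x y r s t : ℝ) ≤
      (Fintype.card G : ℝ) ^ ((r : ℝ) + (s : ℝ) - (t : ℝ) - 2 + 2 * δ) := by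
  rcases lt_or_ge (d + t) (2 * s) with h | h
  · exact crossPairCount_le_rpow hd hNδ x y (hxe r (ht1.trans htr) hrd) hrd hsd hts h
  · rw [crossPairCount_comm, add_comm (r : ℝ)]
    exact crossPairCount_le_rpow hd hNδ y x (hye s (ht1.trans hts) hsd) hsd hrd htr (by omega)
end
end

section
/- Fix γ ∈ (0,1) and let d_N = (1−γ)·√(log N/(2·log log N)). There exists ε₀ > 0 such that for every ε ∈ (0, ε₀) there exists N₀ with the following property. Let G be a finite group of order N ≥ N₀, let d be an integer with 2 ≤ d ≤ d_N, set M = exp(2·√(log N · log log N)), and suppose that G contains at most N^(1/d) elements z with cl(z) ≤ M. Then for every x ∈ G with x² ≠ 1 and cl(x) > M, there are at least (1−ε/4)·N^(d−1) tuples (g₁, …, g_{d−1}) of pairwise distinct elements of G∖{1, x} such that all d!·2^d products of the form h₁^{a₁}⋯h_d^{a_d}, where (h₁, …, h_d) ranges over the permutations of (x, g₁, …, g_{d−1}) and each a_i ∈ {−1, 1}, are pairwise distinct. -/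
open scoped Classical

noncomputable section

/-- `cl(x)`: the size of the conjugacy class of `x`. -/
def cl {G : Type*} [Group G] [Fintype G] [DecidableEq G] (x : G) : ℕ :=
  (Finset.univ.image fun y : G => y⁻¹ * x * y).card

/-- `M = exp(2·√(log N · log log N))`. -/
def Mconst (N : ℕ) : ℝ :=
  Real.exp (2 * Real.sqrt (Real.log N * Real.log (Real.log N)))

/-- The `d`-tuple `(g₁, …, g_{d-1}, x)` consisting of `x` together with the entries of `g`. -/
def extendTuple {G : Type*} (d : ℕ) (x : G) (g : Fin (d - 1) → G) : Fin d → G :=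
  fun i => if h : (i : ℕ) < d - 1 then g ⟨(i : ℕ), h⟩ else x

/-- All `d!·2^d` products `h₁^{a₁}⋯h_d^{a_d}`, where `(h₁,…,h_d)` ranges over the
permutations of the tuple `(x, g₁, …, g_{d-1})` and each `aᵢ ∈ {−1,1}`, are pairwise
distinct. -/
def allProductsDistinct {G : Type*} [Group G] (d : ℕ) (x : G) (g : Fin (d - 1) → G) : Prop :=
  ∀ σ σ' : Equiv.Perm (Fin d), ∀ a a' : Fin d → ℤ,
    (∀ i, a i = 1 ∨ a i = -1) → (∀ i, a' i = 1 ∨ a' i = -1) →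
    (List.ofFn fun i => extendTuple d x g (σ i) ^ a i).prod =
      (List.ofFn fun i => extendTuple d x g (σ' i) ^ a' i).prod →
    σ = σ' ∧ a = a'

theorem card_filter_zpow {G : Type*} [Group G] [Fintype G] {a : ℤ} (ha : a = 1 ∨ a = -1)
    (P : G → Prop) [DecidablePred P] [DecidablePred fun h => P (h ^ a)] :
    (Finset.univ.filter fun h : G => P (h ^ a)).card = (Finset.univ.filter P).card := by
  rcases ha with rfl | rfl
  · simp
  · refine Finset.card_bij (fun h _ => h⁻¹) ?_ ?_ ?_
    · intro h hh
      simpa using hh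
    · intro h _ h' _ e
      simpa using e
    · intro h hh
      exact ⟨h⁻¹, by simpa using hh, by simp⟩

section ConjugacyCounting

variable {G : Type*} [Group G] [Fintype G] [DecidableEq G]

theorem card_conj_eq_mul_cl_le (u v : G) :
    (Finset.univ.filter fun y : G => y⁻¹ * u * y = v).card * cl u ≤ Fintype.card G := by
  rcases (Finset.univ.filter fun y : G => y⁻¹ * u * y = v).eq_empty_or_nonempty with h | ⟨y₀, hy₀⟩
  · simp [h]
  have hy₀' : y₀⁻¹ * u * y₀ = v := by simpa using hy₀
  have key := Finset.card_nsmul_le_sum (Finset.univ.image fun y : G => y⁻¹ * u * y)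
    (fun w => (Finset.univ.filter fun y : G => y⁻¹ * u * y = w).card)
    (Finset.univ.filter fun y : G => y⁻¹ * u * y = v).card ?_
  · rw [← Finset.card_eq_sum_card_image] at key
    rw [mul_comm]
    simpa [cl] using key
  · intro w hw
    obtain ⟨z, -, rfl⟩ := Finset.mem_image.1 hw
    refine Finset.card_le_card_of_injOn (fun y => y * (y₀⁻¹ * z)) ?_ ?_
    · intro y hy
      have hy' : y⁻¹ * u * y = v := by simpa using hy
      simp only [Finset.coe_filter, Finset.mem_univ, true_and, Set.mem_ofPred_eq]
      calc (y * (y₀⁻¹ * z))⁻¹ * u * (y * (y₀⁻¹ * z))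
          = z⁻¹ * y₀ * (y⁻¹ * u * y) * y₀⁻¹ * z := by group
        _ = z⁻¹ * u * z := by rw [hy', ← hy₀']; group
    · intro y _ y' _ h
      simpa using h

theorem cl_inv (u : G) : cl u⁻¹ = cl u := by
  have : (Finset.univ.image fun y : G => y⁻¹ * u⁻¹ * y) =
      (Finset.univ.image fun y : G => y⁻¹ * u * y).image (·⁻¹) := by
    rw [Finset.image_image]
    congr 1
    funext y
    simp [mul_assoc]
  rw [cl, this, Finset.card_image_of_injective _ inv_injective, cl]

/-- The number of elements whose conjugacy class has size at most `M`. -/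
def smallClassCard (G : Type*) [Group G] [Fintype G] [DecidableEq G] (M : ℝ) : ℝ :=
  ((Finset.univ.filter fun z : G => (cl z : ℝ) ≤ M).card : ℝ)

theorem card_conj_eq_le {M : ℝ} (hM : 0 < M) (u v : G) :
    ((Finset.univ.filter fun y : G => y⁻¹ * u * y = v).card : ℝ) ≤
      Fintype.card G / M + Fintype.card G * (if (cl u : ℝ) ≤ M then 1 else 0) := by
  split_ifs with h
  · have h1 : ((Finset.univ.filter fun y : G => y⁻¹ * u * y = v).card : ℝ) ≤ Fintype.card G := by
      exact_mod_cast Finset.card_le_univ _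
    have : 0 ≤ (Fintype.card G : ℝ) / M := by positivity
    linarith
  · rw [mul_zero, add_zero, le_div_iff₀ hM]
    have h1 : ((Finset.univ.filter fun y : G => y⁻¹ * u * y = v).card : ℝ) * cl u ≤
        Fintype.card G := by
      exact_mod_cast card_conj_eq_mul_cl_le u v
    refine le_trans ?_ h1
    gcongr
    exact (not_le.1 h).le

theorem card_sq_eq_sq_le {M : ℝ} (hM : 0 < M) (v : G) :
    ((Finset.univ.filter fun u : G => u * u = v).card : ℝ) ^ 2 ≤
      Fintype.card G * smallClassCard G M + (Fintype.card G : ℝ) ^ 2 / M := by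
  set S := Finset.univ.filter fun u : G => u * u = v with hS
  have h1 : (S ×ˢ S).card ≤
      (Finset.univ.sigma fun t : G => Finset.univ.filter fun u : G => u⁻¹ * t * u = t⁻¹).card := by
    refine Finset.card_le_card_of_injOn (fun p => ⟨p.1⁻¹ * p.2, p.1⟩) ?_ ?_
    · rintro ⟨p, q⟩ hp
      simp only [hS, Finset.coe_product, Finset.coe_filter, Finset.mem_univ, true_and,
        Set.mem_prod, Set.mem_ofPred_eq] at hp
      simp only [Finset.coe_sigma, Finset.coe_univ, Set.mem_sigma_iff, Set.mem_univ,
        Finset.coe_filter, Finset.mem_univ, true_and, Set.mem_ofPred_eq]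
      have : q * q = p * p := hp.2.trans hp.1.symm
      calc p⁻¹ * (p⁻¹ * q) * p = p⁻¹ * p⁻¹ * (q * q) * q⁻¹ * p := by group
        _ = (p⁻¹ * q)⁻¹ := by rw [this]; group
    · rintro ⟨p, q⟩ _ ⟨p', q'⟩ _ h
      simp only [Sigma.mk.injEq, heq_eq_eq] at h
      obtain ⟨h1, rfl⟩ := h
      simpa using h1
  have h2 : ((S ×ˢ S).card : ℝ) ≤ ∑ t : G,
      ((Finset.univ.filter fun u : G => u⁻¹ * t * u = t⁻¹).card : ℝ) := by
    rw [Finset.card_sigma] at h1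
    exact_mod_cast h1
  rw [Finset.card_product, Nat.cast_mul, ← sq] at h2
  refine h2.trans ((Finset.sum_le_sum fun t _ => card_conj_eq_le hM t t⁻¹).trans_eq ?_)
  rw [Finset.sum_add_distrib, ← Finset.mul_sum, Finset.sum_boole, smallClassCard]
  simp only [Finset.sum_const, Finset.card_univ, nsmul_eq_mul]
  ring

theorem card_mul_mul_eq_le {M β : ℝ} (hM : 0 < M) (hβ : 0 ≤ β)
    (h : smallClassCard G M / Fintype.card G + 1 / M ≤ β ^ 2) (m v : G) :
    ((Finset.univ.filter fun k : G => k * m * k = v).card : ℝ) ≤ Fintype.card G * β := by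
  have hN : (0 : ℝ) < Fintype.card G := by exact_mod_cast Fintype.card_pos
  have h1 : (Finset.univ.filter fun k : G => k * m * k = v).card ≤
      (Finset.univ.filter fun u : G => u * u = v * m).card := by
    refine Finset.card_le_card_of_injOn (fun k => k * m) ?_ ?_
    · intro k hk
      have hk' : k * m * k = v := by simpa using hk
      simp [← hk', mul_assoc]
    · intro k _ k' _ h
      simpa using h
  refine le_trans (Nat.cast_le.2 h1) (abs_le_of_sq_le_sq' ?_ (by positivity)).2
  refine (card_sq_eq_sq_le hM (v * m)).trans ?_
  calc Fintype.card G * smallClassCard G M + (Fintype.card G : ℝ) ^ 2 / M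
      = (Fintype.card G : ℝ) ^ 2 * (smallClassCard G M / Fintype.card G + 1 / M) := by
        field_simp
    _ ≤ (Fintype.card G : ℝ) ^ 2 * β ^ 2 := by gcongr
    _ = _ := by ring

end ConjugacyCounting

section Words

variable {G κ : Type*} [Fintype G] [Fintype κ] [DecidableEq κ]

/-- The functions `κ → G` taking the value `x` at `k₀`. -/
def pinned (k₀ : κ) (x : G) : Finset (κ → G) :=
  Finset.univ.filter fun f => f k₀ = x

/-- The number of functions pinned to `x` at `k₀` and satisfying `P`. -/
def pinnedCount (k₀ : κ) (x : G) (P : (κ → G) → Prop) : ℝ :=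
  ((pinned k₀ x).filter P).card

theorem pinnedCount_mono {k₀ : κ} {x : G} {P Q : (κ → G) → Prop}
    (h : ∀ f, f k₀ = x → P f → Q f) : pinnedCount k₀ x P ≤ pinnedCount k₀ x Q := by
  unfold pinnedCount
  norm_cast
  refine Finset.card_le_card fun f hf => ?_
  simp only [pinned, Finset.mem_filter, Finset.mem_univ, true_and] at hf ⊢
  exact ⟨hf.1, h f hf.1 hf.2⟩

theorem pinnedCount_eq_zero {k₀ : κ} {x : G} {P : (κ → G) → Prop}
    (h : ∀ f, f k₀ = x → ¬ P f) : pinnedCount k₀ x P = 0 := by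
  unfold pinnedCount
  norm_cast
  rw [Finset.card_eq_zero, Finset.filter_eq_empty_iff]
  intro f hf
  exact h f (by simpa [pinned] using hf)

theorem sum_pinned_update {k₀ j : κ} (hj : j ≠ k₀) (x : G) (F : (κ → G) → ℝ) :
    ∑ f ∈ pinned k₀ x, ∑ h : G, F (Function.update f j h) =
      Fintype.card G * ∑ f ∈ pinned k₀ x, F f := by
  rw [← Finset.sum_product', Finset.mul_sum]
  have : ∑ f ∈ pinned k₀ x, (Fintype.card G : ℝ) * F f =
      ∑ p ∈ pinned k₀ x ×ˢ (Finset.univ : Finset G), F p.1 := by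
    rw [Finset.sum_product]
    simp
  rw [this]
  refine Finset.sum_nbij' (fun p => (Function.update p.1 j p.2, p.1 j))
    (fun p => (Function.update p.1 j p.2, p.1 j)) ?_ ?_ ?_ ?_ ?_
  · rintro ⟨f, h⟩ hf
    simpa [pinned, Function.update_of_ne hj.symm] using hf
  · rintro ⟨f, h⟩ hf
    simpa [pinned, Function.update_of_ne hj.symm] using hf
  · rintro ⟨f, h⟩ _
    simp
  · rintro ⟨f, h⟩ _
    simp
  · rintro ⟨f, h⟩ _
    rfl

theorem card_mul_pinnedCount_le {k₀ j : κ} (hj : j ≠ k₀) {x : G} {P : (κ → G) → Prop}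
    {B : (κ → G) → ℝ}
    (hB : ∀ f, f k₀ = x →
      ((Finset.univ.filter fun h : G => P (Function.update f j h)).card : ℝ) ≤ B f) :
    Fintype.card G * pinnedCount k₀ x P ≤ ∑ f ∈ pinned k₀ x, B f := by
  rw [pinnedCount, ← Finset.sum_boole, ← sum_pinned_update hj]
  refine Finset.sum_le_sum fun f hf => ?_
  rw [Finset.sum_boole]
  exact hB f (by simpa [pinned] using hf)

end Words

/-- The value of `F` at `f` does not depend on the coordinate `f j`. -/
def IndepOf {G κ : Type*} [DecidableEq κ] (j : κ) (F : (κ → G) → G) : Prop :=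
  ∀ f h, F (Function.update f j h) = F f

section WordEval

variable {G κ : Type*} [Group G]

/-- The value at `f` of a word whose letters are pairs (index, exponent). -/
def wordEval (l : List (κ × ℤ)) (f : κ → G) : G :=
  (l.map fun p => f p.1 ^ p.2).prod

@[simp]
theorem wordEval_nil (f : κ → G) : wordEval [] f = 1 := rfl

@[simp]
theorem wordEval_cons (p : κ × ℤ) (l : List (κ × ℤ)) (f : κ → G) :
    wordEval (p :: l) f = f p.1 ^ p.2 * wordEval l f := by
  simp [wordEval]

theorem wordEval_append (l l' : List (κ × ℤ)) (f : κ → G) :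
    wordEval (l ++ l') f = wordEval l f * wordEval l' f := by
  simp [wordEval]

theorem wordEval_update [DecidableEq κ] {l : List (κ × ℤ)} {j : κ} (hj : j ∉ l.map Prod.fst)
    (f : κ → G) (h : G) : wordEval l (Function.update f j h) = wordEval l f := by
  unfold wordEval
  congr 1
  refine List.map_congr_left fun p hp => ?_
  rw [Function.update_of_ne]
  rintro rfl
  exact hj (List.mem_map_of_mem hp)

theorem indepOf_wordEval [DecidableEq κ] {l : List (κ × ℤ)} {j : κ} (hj : j ∉ l.map Prod.fst) :
    IndepOf j (wordEval l : (κ → G) → G) :=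
  wordEval_update hj

/-- A word in which each index occurs at most once, with exponents `±1`. -/
def IsSimpleWord (l : List (κ × ℤ)) : Prop :=
  (l.map Prod.fst).Nodup ∧ ∀ p ∈ l, p.2 = 1 ∨ p.2 = -1

theorem IsSimpleWord.tail {p : κ × ℤ} {l : List (κ × ℤ)} (h : IsSimpleWord (p :: l)) :
    IsSimpleWord l :=
  ⟨by simpa using (List.nodup_cons.1 h.1).2, fun q hq => h.2 q (List.mem_cons_of_mem _ hq)⟩

end WordEval

section Equations

variable {G κ : Type*} [Group G] [Fintype G] [DecidableEq G] [Fintype κ] [DecidableEq κ]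
variable {M β : ℝ} {k₀ j : κ} {x : G}

theorem pinnedCount_small_le (hj : j ≠ k₀) {A B : (κ → G) → G} (hA : IndepOf j A)
    (hB : IndepOf j B) {b : ℤ} (hb : b = 1 ∨ b = -1) :
    Fintype.card G * pinnedCount k₀ x (fun f => (cl (A f * (f j ^ b * B f)) : ℝ) ≤ M) ≤
      (pinned k₀ x).card * smallClassCard G M := by
  refine (card_mul_pinnedCount_le hj (B := fun _ => smallClassCard G M) ?_).trans_eq (by simp)
  intro f _
  simp only [hA f, hB f, Function.update_self]
  rw [card_filter_zpow hb fun h => (cl (A f * (h * B f)) : ℝ) ≤ M, smallClassCard]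
  norm_cast
  refine Finset.card_le_card_of_injOn (fun h => A f * (h * B f)) ?_ ?_
  · intro h hh
    simpa using hh
  · intro h _ h' _ e
    simpa using e

theorem pinnedCount_conj_le (hM : 0 < M) (hβ : 0 ≤ β) (hβ1 : β ≤ 1)
    (hβM : smallClassCard G M / Fintype.card G + 1 / M ≤ β ^ 2) (hj : j ≠ k₀)
    {c R C D : (κ → G) → G} (hc : IndepOf j c) (hR : IndepOf j R) (hC : IndepOf j C)
    (hD : IndepOf j D) {a : ℤ} (ha : a = 1 ∨ a = -1)
    (hsmall : Fintype.card G * pinnedCount k₀ x (fun f => (cl ((c f)⁻¹ * C f) : ℝ) ≤ M) ≤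
      (pinned k₀ x).card * smallClassCard G M) :
    pinnedCount k₀ x (fun f => c f * (f j ^ a * R f) = C f * (f j ^ a * D f)) ≤
      β * (pinned k₀ x).card := by
  have hN : (0 : ℝ) < Fintype.card G := by exact_mod_cast Fintype.card_pos
  have h1 := card_mul_pinnedCount_le (x := x) hj
    (P := fun f => c f * (f j ^ a * R f) = C f * (f j ^ a * D f))
    (B := fun f => Fintype.card G / M +
      Fintype.card G * (if (cl ((c f)⁻¹ * C f) : ℝ) ≤ M then 1 else 0)) ?_
  · rw [Finset.sum_add_distrib, ← Finset.mul_sum, Finset.sum_boole, Finset.sum_const,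
      nsmul_eq_mul] at h1
    change _ ≤ _ + Fintype.card G * pinnedCount k₀ x _ at h1
    have h2 := h1.trans (add_le_add_right hsmall _)
    refine le_of_mul_le_mul_left ?_ hN
    calc _ ≤ _ := h2
      _ = Fintype.card G * ((smallClassCard G M / Fintype.card G + 1 / M) *
          (pinned k₀ x).card) := by field_simp; ring
      _ ≤ Fintype.card G * (β * (pinned k₀ x).card) := by
        gcongr
        nlinarith
  · intro f _
    simp only [hc f, hR f, hC f, hD f, Function.update_self]
    rw [card_filter_zpow ha fun h => c f * (h * R f) = C f * (h * D f)]
    refine le_trans (le_of_eq ?_) (card_conj_eq_le hM ((c f)⁻¹ * C f) (R f * (D f)⁻¹))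
    congr 2
    ext h
    simp only [Finset.mem_filter, Finset.mem_univ, true_and]
    constructor
    · intro e
      have : C f = c f * (h * R f) * (D f)⁻¹ * h⁻¹ := by rw [e]; group
      rw [this]; group
    · intro e
      have : R f = h⁻¹ * ((c f)⁻¹ * C f) * h * D f := by rw [e]; group
      rw [this]; group

theorem pinnedCount_inv_le (hM : 0 < M) (hβ : 0 ≤ β)
    (hβM : smallClassCard G M / Fintype.card G + 1 / M ≤ β ^ 2) (hj : j ≠ k₀)
    {c R C D : (κ → G) → G} (hc : IndepOf j c) (hR : IndepOf j R) (hC : IndepOf j C)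
    (hD : IndepOf j D) {a : ℤ} (ha : a = 1 ∨ a = -1) :
    pinnedCount k₀ x (fun f => c f * (f j ^ a * R f) = C f * (f j ^ (-a) * D f)) ≤
      β * (pinned k₀ x).card := by
  have hN : (0 : ℝ) < Fintype.card G := by exact_mod_cast Fintype.card_pos
  have h1 := card_mul_pinnedCount_le (x := x) hj
    (P := fun f => c f * (f j ^ a * R f) = C f * (f j ^ (-a) * D f))
    (B := fun _ => Fintype.card G * β) ?_
  · refine le_of_mul_le_mul_left (h1.trans_eq ?_) hN
    rw [Finset.sum_const, nsmul_eq_mul]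
    ring
  · intro f _
    simp only [hc f, hR f, hC f, hD f, Function.update_self, zpow_neg]
    rw [card_filter_zpow ha fun h => c f * (h * R f) = C f * (h⁻¹ * D f)]
    refine le_trans (Nat.cast_le.2 (Finset.card_le_card ?_))
      (card_mul_mul_eq_le hM hβ hβM (R f * (D f)⁻¹) ((c f)⁻¹ * C f))
    intro h
    simp only [Finset.mem_filter, Finset.mem_univ, true_and]
    intro e
    have : C f = c f * (h * R f) * (D f)⁻¹ * h := by rw [e]; group
    rw [this]; group

end Equations

section WordEquations

variable {G κ : Type*} [Group G] [Fintype G] [DecidableEq G] [Fintype κ] [DecidableEq κ]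
variable {M β : ℝ} {k₀ : κ} {x : G}

theorem pinnedCount_small_initial_le (hx : M < cl x) {c : (κ → G) → G} {i : κ} {b : ℤ}
    {s : List (κ × ℤ)} (hs : IsSimpleWord ((i, b) :: s))
    (hc : ∀ q ∈ (i, b) :: s, q.1 ≠ k₀ → IndepOf q.1 c) (hi : i ≠ k₀ ∨ c = 1) :
    Fintype.card G *
        pinnedCount k₀ x (fun f => (cl ((c f)⁻¹ * wordEval ((i, b) :: s) f) : ℝ) ≤ M) ≤
      (pinned k₀ x).card * smallClassCard G M := by
  have hnn : 0 ≤ ((pinned k₀ x).card : ℝ) * smallClassCard G M := by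
    unfold smallClassCard; positivity
  have hb : b = 1 ∨ b = -1 := hs.2 (i, b) (by simp)
  have his : i ∉ s.map Prod.fst := (List.nodup_cons.1 hs.1).1
  by_cases hik : i = k₀
  · obtain rfl : c = 1 := hi.resolve_left (by simp [hik])
    subst hik
    rcases s with _ | ⟨⟨l, e⟩, s⟩
    · rw [pinnedCount_eq_zero, mul_zero]
      · exact hnn
      · rintro f rfl
        rcases hb with rfl | rfl <;> simpa [cl_inv] using hx
    · have hl : l ≠ i := by
        rintro rfl
        simp at his
      have hls : l ∉ s.map Prod.fst := (List.nodup_cons.1 hs.tail.1).1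
      have he : e = 1 ∨ e = -1 := hs.2 (l, e) (by simp)
      have := pinnedCount_small_le (M := M) (x := x) (A := fun f : κ → G => f i ^ b) hl
        (fun f h => by simp [Function.update_of_ne hl.symm]) (indepOf_wordEval hls) he
      simpa using this
  · have h1 := hc (i, b) (by simp) hik
    have := pinnedCount_small_le (M := M) (x := x) (A := fun f : κ → G => (c f)⁻¹) hik
      (fun f h => congrArg (·⁻¹) (h1 f h)) (indepOf_wordEval his) hb
    simpa using this

theorem pinnedCount_eq_le_of_head_ne (hM : 0 < M) (hβ : 0 ≤ β) (hβ1 : β ≤ 1)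
    (hβM : smallClassCard G M / Fintype.card G + 1 / M ≤ β ^ 2) (hx : M < cl x)
    {c : (κ → G) → G} {j i : κ} {a b : ℤ} {u v : List (κ × ℤ)} (hj : j ≠ k₀) (hji : j ≠ i)
    (hu : IsSimpleWord ((j, a) :: u)) (hv : IsSimpleWord ((i, b) :: v))
    (huv : (((j, a) :: u).map Prod.fst).Perm (((i, b) :: v).map Prod.fst))
    (hc : ∀ q ∈ (i, b) :: v, q.1 ≠ k₀ → IndepOf q.1 c) (hi : i ≠ k₀ ∨ c = 1) :
    pinnedCount k₀ x (fun f => c f * wordEval ((j, a) :: u) f = wordEval ((i, b) :: v) f) ≤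
      β * (pinned k₀ x).card := by
  have hjv : j ∈ ((i, b) :: v).map Prod.fst := huv.subset (by simp)
  obtain ⟨⟨j', a'⟩, hp, hjj⟩ : ∃ p ∈ v, p.1 = j := by simpa [hji] using hjv
  obtain rfl : j' = j := hjj
  obtain ⟨s, t, rfl⟩ := List.append_of_mem hp
  have ha : a = 1 ∨ a = -1 := hu.2 (j', a) (by simp)
  have ha' : a' = 1 ∨ a' = -1 := hv.2 (j', a') (by simp)
  have hju : j' ∉ u.map Prod.fst := (List.nodup_cons.1 hu.1).1
  have hnd := hv.1
  rw [List.map_cons, List.map_append, List.map_cons, ← List.cons_append,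
    List.nodup_append'] at hnd
  obtain ⟨hs1, hs2, hs3⟩ := hnd
  have hjt : j' ∉ t.map Prod.fst := (List.nodup_cons.1 hs2).1
  have hjs : j' ∉ ((i, b) :: s).map Prod.fst := fun h => hs3 h (by simp)
  have hs : IsSimpleWord ((i, b) :: s) := ⟨hs1, fun p hp => hv.2 p (by simp at hp ⊢; tauto)⟩
  have hcj : IndepOf j' c := hc (j', a') (by simp) hj
  have key : ∀ f : κ → G, wordEval ((i, b) :: (s ++ (j', a') :: t)) f =
      wordEval ((i, b) :: s) f * (f j' ^ a' * wordEval t f) := by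
    intro f
    rw [← List.cons_append, wordEval_append, wordEval_cons (j', a')]
  simp only [key]
  simp only [wordEval_cons (j', a)]
  obtain rfl | rfl : a' = a ∨ a' = -a := by omega
  · exact pinnedCount_conj_le hM hβ hβ1 hβM hj hcj (indepOf_wordEval hju)
      (indepOf_wordEval hjs) (indepOf_wordEval hjt) ha
      (pinnedCount_small_initial_le hx hs (fun q hq => hc q (by simp at hq ⊢; tauto)) hi)
  · exact pinnedCount_inv_le hM hβ hβM hj hcj (indepOf_wordEval hju)
      (indepOf_wordEval hjs) (indepOf_wordEval hjt) ha

/-- Distinct words avoiding the pinned index rarely agree up to a factor depending only on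
other coordinates. -/
theorem pinnedCount_mul_wordEval_eq_le (hM : 0 < M) (hβ : 0 ≤ β) (hβ1 : β ≤ 1)
    (hβM : smallClassCard G M / Fintype.card G + 1 / M ≤ β ^ 2) (hx : M < cl x)
    {u v : List (κ × ℤ)} (hu : IsSimpleWord u) (hv : IsSimpleWord v)
    (huv : (u.map Prod.fst).Perm (v.map Prod.fst)) (hk : k₀ ∉ v.map Prod.fst) (hne : u ≠ v)
    {c : (κ → G) → G} (hc : ∀ q ∈ v, IndepOf q.1 c) :
    pinnedCount k₀ x (fun f => c f * wordEval u f = wordEval v f) ≤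
      β * (pinned k₀ x).card := by
  induction u generalizing v c with
  | nil => exact absurd (by simpa using huv.length_eq.symm) (Ne.symm hne)
  | cons p u ih =>
    rcases v with _ | ⟨q, v⟩
    · simp at huv
    obtain ⟨j, a⟩ := p
    obtain ⟨i, b⟩ := q
    have hjk : j ≠ k₀ := by
      rintro rfl
      exact hk (huv.subset (by simp))
    have hik : i ≠ k₀ := by
      rintro rfl
      simp at hk
    by_cases hji : j = i
    · subst hji
      have huv' : (u.map Prod.fst).Perm (v.map Prod.fst) := by simpa using huv
      have hjv : j ∉ v.map Prod.fst := (List.nodup_cons.1 hv.1).1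
      have hju : j ∉ u.map Prod.fst := (List.nodup_cons.1 hu.1).1
      have hcj : IndepOf j c := hc (j, b) (by simp)
      have ha : a = 1 ∨ a = -1 := hu.2 (j, a) (by simp)
      have hb : b = 1 ∨ b = -1 := hv.2 (j, b) (by simp)
      obtain rfl | rfl : b = a ∨ b = -a := by omega
      · have h1 := ih (c := fun f => (f j ^ b)⁻¹ * c f * f j ^ b) hu.tail hv.tail huv'
          (fun h => hk (by simp at h ⊢; tauto)) (by simpa using hne) ?_
        · refine le_trans (pinnedCount_mono fun f _ e => ?_) h1
          simp only [wordEval_cons] at e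
          calc (f j ^ b)⁻¹ * c f * f j ^ b * wordEval u f
              = (f j ^ b)⁻¹ * (c f * (f j ^ b * wordEval u f)) := by group
            _ = wordEval v f := by rw [e]; group
        · intro q hq f h
          have hqj : j ≠ q.1 := by
            rintro rfl
            exact hjv (List.mem_map_of_mem hq)
          simp only [Function.update_of_ne hqj, hc q (List.mem_cons_of_mem _ hq) f h]
      · have := pinnedCount_inv_le (x := x) (C := fun _ : κ → G => 1) hM hβ hβM hjk hcj
          (indepOf_wordEval hju) (fun _ _ => rfl) (indepOf_wordEval hjv) ha
        simpa only [wordEval_cons, one_mul] using this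
    · exact pinnedCount_eq_le_of_head_ne hM hβ hβ1 hβM hx hjk hji hu hv huv
        (fun q hq _ => hc q hq) (Or.inl hik)

/-- Distinct words rarely agree at a function pinned to an element with a large class. -/
theorem pinnedCount_wordEval_eq_le (hM : 0 < M) (hβ : 0 ≤ β) (hβ1 : β ≤ 1)
    (hβM : smallClassCard G M / Fintype.card G + 1 / M ≤ β ^ 2) (hx : M < cl x)
    (hxx : x * x ≠ 1) {u v : List (κ × ℤ)} (hu : IsSimpleWord u) (hv : IsSimpleWord v)
    (huv : (u.map Prod.fst).Perm (v.map Prod.fst)) (hne : u ≠ v) :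
    pinnedCount k₀ x (fun f => wordEval u f = wordEval v f) ≤ β * (pinned k₀ x).card := by
  induction u generalizing v with
  | nil => exact absurd (by simpa using huv.length_eq.symm) (Ne.symm hne)
  | cons p u ih =>
    rcases v with _ | ⟨q, v⟩
    · simp at huv
    obtain ⟨j, a⟩ := p
    obtain ⟨i, b⟩ := q
    by_cases hji : j = i
    · subst hji
      have huv' : (u.map Prod.fst).Perm (v.map Prod.fst) := by simpa using huv
      have hjv : j ∉ v.map Prod.fst := (List.nodup_cons.1 hv.1).1
      have hju : j ∉ u.map Prod.fst := (List.nodup_cons.1 hu.1).1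
      have ha : a = 1 ∨ a = -1 := hu.2 (j, a) (by simp)
      have hb : b = 1 ∨ b = -1 := hv.2 (j, b) (by simp)
      obtain rfl | rfl : b = a ∨ b = -a := by omega
      · simpa using ih hu.tail hv.tail huv' (by simpa using hne)
      · by_cases hjk : j = k₀
        · subst hjk
          by_cases hne' : u = v
          · subst hne'
            rw [pinnedCount_eq_zero]
            · positivity
            · rintro f rfl e
              rcases ha with rfl | rfl
              · exact hxx (by simpa [eq_inv_iff_mul_eq_one] using e)
              · exact hxx (by simpa [inv_eq_iff_mul_eq_one] using e)
          · refine le_trans (pinnedCount_mono fun f hf e => ?_)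
              (pinnedCount_mul_wordEval_eq_le hM hβ hβ1 hβM hx hu.tail hv.tail huv' hjv hne'
                (c := fun _ => x ^ a * x ^ a) fun _ _ _ _ => rfl)
            simp only [wordEval_cons, hf, zpow_neg] at e
            rw [mul_assoc, e, mul_inv_cancel_left]
        · have := pinnedCount_inv_le (x := x) (C := fun _ : κ → G => 1)
            (c := fun _ : κ → G => 1) hM hβ hβM hjk (fun _ _ => rfl)
            (indepOf_wordEval hju) (fun _ _ => rfl) (indepOf_wordEval hjv) ha
          simpa only [wordEval_cons, one_mul] using this
    · by_cases hjk : j = k₀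
      · have := pinnedCount_eq_le_of_head_ne (c := 1) hM hβ hβ1 hβM hx
          (fun h => hji (hjk.trans h.symm)) (Ne.symm hji) hv hu huv.symm
          (fun _ _ _ _ _ => rfl) (Or.inr rfl)
        simpa only [Pi.one_apply, one_mul, eq_comm] using this
      · have := pinnedCount_eq_le_of_head_ne (c := 1) hM hβ hβ1 hβM hx hjk hji hu hv huv
          (fun _ _ _ _ _ => rfl) (Or.inr rfl)
        simpa only [Pi.one_apply, one_mul] using this

end WordEquations

section ExtendTuple

variable {G : Type*}

theorem extendTuple_castLE {d : ℕ} (x : G) (g : Fin (d - 1) → G) (i : Fin (d - 1)) :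
    extendTuple d x g (Fin.castLE (Nat.sub_le d 1) i) = g i := by
  simp [extendTuple]

theorem extendTuple_last {d : ℕ} (hd : d - 1 < d) (x : G) (g : Fin (d - 1) → G) :
    extendTuple d x g ⟨d - 1, hd⟩ = x := by
  simp [extendTuple]

theorem card_filter_extendTuple [Fintype G] {d : ℕ} (hd : d - 1 < d) (x : G)
    (P : (Fin d → G) → Prop) [DecidablePred P]
    [DecidablePred fun g : Fin (d - 1) → G => P (extendTuple d x g)] :
    (Finset.univ.filter fun g : Fin (d - 1) → G => P (extendTuple d x g)).card =
      ((pinned ⟨d - 1, hd⟩ x).filter P).card := by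
  refine Finset.card_bij (fun g _ => extendTuple d x g) ?_ ?_ ?_
  · intro g hg
    simp only [Finset.mem_filter, Finset.mem_univ, true_and] at hg
    simpa [pinned, extendTuple_last] using hg
  · intro g _ g' _ e
    funext i
    rw [← extendTuple_castLE x g, e, extendTuple_castLE]
  · intro f hf
    simp only [pinned, Finset.mem_filter, Finset.mem_univ, true_and] at hf
    have : extendTuple d x (fun i => f (Fin.castLE (Nat.sub_le d 1) i)) = f := by
      funext i
      unfold extendTuple
      split_ifs with h
      · rfl
      · rw [← hf.1]
        congr 1
        ext
        simp only
        omega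
    exact ⟨_, by simpa [this] using hf.2, this⟩

theorem card_pinned [Fintype G] {d : ℕ} (hd : d - 1 < d) (x : G) :
    (pinned (⟨d - 1, hd⟩ : Fin d) x).card = Fintype.card G ^ (d - 1) := by
  have := card_filter_extendTuple hd x fun _ => True
  simpa using this.symm

end ExtendTuple

section SignedPermutations

variable {G : Type*} [Group G]

/-- The word `σ 0 ^ a 0, …, σ (d - 1) ^ a (d - 1)`. -/
def signedPermWord {d : ℕ} (p : Equiv.Perm (Fin d) × (Fin d → ℤ)) : List (Fin d × ℤ) :=
  List.ofFn fun i => (p.1 i, p.2 i)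

theorem signedPermWord_injective {d : ℕ} : Function.Injective (signedPermWord (d := d)) := by
  rintro ⟨σ, a⟩ ⟨σ', a'⟩ h
  have h' := fun i => congrFun (List.ofFn_injective h) i
  simp only [Prod.mk.injEq] at h'
  exact Prod.ext (Equiv.ext fun i => (h' i).1) (funext fun i => (h' i).2)

theorem map_fst_signedPermWord {d : ℕ} (p : Equiv.Perm (Fin d) × (Fin d → ℤ)) :
    (signedPermWord p).map Prod.fst = List.ofFn p.1 := by
  simp [signedPermWord, List.map_ofFn, Function.comp_def]

theorem wordEval_signedPermWord {d : ℕ} (p : Equiv.Perm (Fin d) × (Fin d → ℤ)) (f : Fin d → G) :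
    wordEval (signedPermWord p) f = (List.ofFn fun i => f (p.1 i) ^ p.2 i).prod := by
  simp [wordEval, signedPermWord, List.map_ofFn, Function.comp_def]

/-- The permutations of `Fin d` decorated with signs. -/
def signedPerms (d : ℕ) : Finset (Equiv.Perm (Fin d) × (Fin d → ℤ)) :=
  Finset.univ ×ˢ Fintype.piFinset fun _ => {1, -1}

theorem mem_signedPerms {d : ℕ} {p : Equiv.Perm (Fin d) × (Fin d → ℤ)} :
    p ∈ signedPerms d ↔ ∀ i, p.2 i = 1 ∨ p.2 i = -1 := by
  simp [signedPerms]

theorem card_signedPerms_le (d : ℕ) : (signedPerms d).card ≤ (2 * d) ^ d := by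
  have : (signedPerms d).card = d.factorial * 2 ^ d := by
    simp [signedPerms, Fintype.card_perm]
  rw [this, mul_pow, mul_comm]
  gcongr
  exact Nat.factorial_le_pow d

theorem isSimpleWord_signedPermWord {d : ℕ} {p : Equiv.Perm (Fin d) × (Fin d → ℤ)}
    (hp : p ∈ signedPerms d) : IsSimpleWord (signedPermWord p) := by
  refine ⟨?_, ?_⟩
  · rw [map_fst_signedPermWord, List.nodup_ofFn]
    exact p.1.injective
  · intro q hq
    obtain ⟨i, rfl⟩ := List.mem_ofFn.1 hq
    exact mem_signedPerms.1 hp i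

theorem perm_map_fst_signedPermWord {d : ℕ} (p q : Equiv.Perm (Fin d) × (Fin d → ℤ)) :
    ((signedPermWord p).map Prod.fst).Perm ((signedPermWord q).map Prod.fst) := by
  rw [map_fst_signedPermWord, map_fst_signedPermWord]
  refine (List.perm_ext_iff_of_nodup (List.nodup_ofFn.2 p.1.injective)
    (List.nodup_ofFn.2 q.1.injective)).2 fun i => ?_
  simp only [List.mem_ofFn]
  exact iff_of_true (p.1.surjective i) (q.1.surjective i)

theorem allProductsDistinct_iff {d : ℕ} {x : G} {g : Fin (d - 1) → G} :
    allProductsDistinct d x g ↔ ∀ p ∈ signedPerms d, ∀ q ∈ signedPerms d,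
      wordEval (signedPermWord p) (extendTuple d x g) =
        wordEval (signedPermWord q) (extendTuple d x g) → p = q := by
  simp only [wordEval_signedPermWord, mem_signedPerms, Prod.forall, Prod.mk.injEq]
  constructor
  · intro h σ a ha σ' a' ha' e
    exact h σ σ' a a' ha ha' e
  · intro h σ σ' a a' ha ha' e
    exact h σ a ha σ' a' ha' e

theorem allProductsDistinct.injective_extendTuple {d : ℕ} {x : G} {g : Fin (d - 1) → G}
    (h : allProductsDistinct d x g) : Function.Injective (extendTuple d x g) := by
  intro i j hij
  have := h 1 (Equiv.swap i j) 1 1 (by simp) (by simp) ?_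
  · simpa using congrArg (fun σ => σ i) this.1
  · congr 2
    funext k
    rw [Equiv.Perm.one_apply]
    congr 1
    rw [Equiv.swap_apply_def]
    split_ifs with h1 h2
    · rw [h1, hij]
    · rw [h2, hij]
    · rfl

theorem allProductsDistinct.extendTuple_ne_one {d : ℕ} {x : G} {g : Fin (d - 1) → G}
    (h : allProductsDistinct d x g) (i : Fin d) : extendTuple d x g i ≠ 1 := by
  intro hi
  have := h 1 1 1 (Function.update 1 i (-1)) (by simp) ?_ ?_
  · simpa using congrFun this.2 i
  · intro k
    by_cases hk : k = i
    · simp [hk]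
    · simp [Function.update_of_ne hk]
  · congr 2
    funext k
    by_cases hk : k = i
    · simp [hk, hi]
    · simp [Function.update_of_ne hk]

theorem allProductsDistinct.generic {d : ℕ} (hd : d - 1 < d) {x : G} {g : Fin (d - 1) → G}
    (h : allProductsDistinct d x g) :
    Function.Injective g ∧ (∀ i, g i ≠ 1 ∧ g i ≠ x) ∧ allProductsDistinct d x g := by
  refine ⟨fun i j hij => ?_, fun i => ⟨?_, fun hi => ?_⟩, h⟩
  · rw [← extendTuple_castLE x g, ← extendTuple_castLE x g j] at hij
    exact Fin.castLE_injective _ (h.injective_extendTuple hij)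
  · rw [← extendTuple_castLE x g]
    exact h.extendTuple_ne_one _
  · rw [← extendTuple_castLE x g] at hi
    nth_rewrite 2 [← extendTuple_last hd x g] at hi
    have := congrArg Fin.val (h.injective_extendTuple hi)
    simp only [Fin.val_castLE] at this
    omega

theorem le_card_allProductsDistinct [Fintype G] [DecidableEq G] {M β : ℝ} (hM : 0 < M) (hβ : 0 ≤ β)
    (hβ1 : β ≤ 1) (hβM : smallClassCard G M / Fintype.card G + 1 / M ≤ β ^ 2) {x : G}
    (hx : M < cl x) (hxx : x * x ≠ 1) {d : ℕ} (hd : d - 1 < d) :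
    (1 - (2 * d) ^ (2 * d) * β) * (Fintype.card G : ℝ) ^ (d - 1) ≤
      ((Finset.univ.filter fun g : Fin (d - 1) → G => allProductsDistinct d x g).card : ℝ) := by
  set Good : (Fin d → G) → Prop := fun f => ∀ p ∈ signedPerms d, ∀ q ∈ signedPerms d,
    wordEval (signedPermWord p) f = wordEval (signedPermWord q) f → p = q with hGood
  set Ω := pinned (⟨d - 1, hd⟩ : Fin d) x with hΩ
  have hcard : (Finset.univ.filter fun g : Fin (d - 1) → G => allProductsDistinct d x g).card =
      (Ω.filter Good).card := by
    rw [hΩ, ← card_filter_extendTuple hd x Good]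
    exact congrArg _ (Finset.filter_congr fun g _ => allProductsDistinct_iff)
  have hΩc : (Ω.card : ℝ) = (Fintype.card G : ℝ) ^ (d - 1) := by
    rw [card_pinned hd]
    push_cast
    rfl
  have hbad : ((Ω.filter fun f => ¬ Good f).card : ℝ) ≤
      ∑ pq ∈ (signedPerms d).offDiag, pinnedCount (⟨d - 1, hd⟩ : Fin d) x
        (fun f => wordEval (signedPermWord pq.1) f = wordEval (signedPermWord pq.2) f) := by
    unfold pinnedCount
    norm_cast
    refine le_trans (Finset.card_le_card ?_) Finset.card_biUnion_le
    intro f hf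
    simp only [hGood, Finset.mem_filter, not_forall] at hf
    obtain ⟨hf, p, hp, q, hq, e, hne⟩ := hf
    simp only [Finset.mem_biUnion, Finset.mem_filter, Finset.mem_offDiag]
    exact ⟨(p, q), ⟨hp, hq, hne⟩, hf, e⟩
  have hsum : ((Ω.filter fun f => ¬ Good f).card : ℝ) ≤ (2 * d) ^ (2 * d) * (β * Ω.card) := by
    refine hbad.trans ((Finset.sum_le_card_nsmul _ _ (β * Ω.card) ?_).trans ?_)
    · rintro ⟨p, q⟩ hpq
      obtain ⟨hp, hq, hne⟩ := Finset.mem_offDiag.1 hpq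
      exact pinnedCount_wordEval_eq_le hM hβ hβ1 hβM hx hxx (isSimpleWord_signedPermWord hp)
        (isSimpleWord_signedPermWord hq) (perm_map_fst_signedPermWord p q)
        (signedPermWord_injective.ne hne)
    · rw [nsmul_eq_mul]
      gcongr
      have : (signedPerms d).offDiag.card ≤ (2 * d) ^ (2 * d) := by
        calc (signedPerms d).offDiag.card ≤ (signedPerms d).card * (signedPerms d).card := by
              rw [Finset.offDiag_card]; exact Nat.sub_le _ _
          _ ≤ (2 * d) ^ d * (2 * d) ^ d := by gcongr <;> exact card_signedPerms_le d
          _ = _ := by rw [two_mul d, pow_add]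
      exact_mod_cast this
  have hsplit : ((Ω.filter Good).card : ℝ) + (Ω.filter fun f => ¬ Good f).card = Ω.card := by
    exact_mod_cast Finset.card_filter_add_card_filter_not Good
  rw [← hΩc, hcard]
  linarith

end SignedPermutations

section Asymptotics

open Filter Topology

theorem exists_forall_log_bounds {ε : ℝ} (hε : 0 < ε) :
    ∃ N₀ : ℕ, ∀ N : ℕ, N₀ ≤ N → 2 ≤ Real.log (Real.log N) ∧
      16 * Real.log (Real.log N) ≤ Real.log N ∧
      1 ≤ √(Real.log N * Real.log (Real.log N)) ∧
      2 * Real.exp (-(√(Real.log N * Real.log (Real.log N)) / 4)) ≤ ε := by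
  have hL : Tendsto (fun N : ℕ => Real.log N) atTop atTop :=
    Real.tendsto_log_atTop.comp tendsto_natCast_atTop_atTop
  have hl : Tendsto (fun N : ℕ => Real.log (Real.log N)) atTop atTop :=
    Real.tendsto_log_atTop.comp hL
  have hs : Tendsto (fun N : ℕ => √(Real.log N * Real.log (Real.log N))) atTop atTop :=
    Real.tendsto_sqrt_atTop.comp (hL.atTop_mul_atTop₀ hl)
  have he : Tendsto (fun N : ℕ => 2 * Real.exp (-(√(Real.log N * Real.log (Real.log N)) / 4)))
      atTop (𝓝 0) := by
    have := (Real.tendsto_exp_neg_atTop_nhds_zero.comp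
      (hs.atTop_div_const (show (0 : ℝ) < 4 by norm_num))).const_mul 2
    simpa using this
  have ho : ∀ᶠ N : ℕ in atTop, 16 * Real.log (Real.log N) ≤ Real.log N := by
    have h1 := Real.isLittleO_log_id_atTop.def (show (0 : ℝ) < 1 / 16 by norm_num)
    filter_upwards [hL.eventually h1, hL.eventually_ge_atTop 0] with N hN hN0
    simp only [Real.norm_eq_abs, id, abs_of_nonneg hN0] at hN
    linarith [le_abs_self (Real.log (Real.log N))]
  obtain ⟨N₀, h⟩ := eventually_atTop.1 (((hl.eventually_ge_atTop 2).and ho).and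
    ((hs.eventually_ge_atTop 1).and (he.eventually_le_const hε)))
  exact ⟨N₀, fun N hN => ⟨(h N hN).1.1, (h N hN).1.2, (h N hN).2.1, (h N hN).2.2⟩⟩

theorem two_mul_pow_le_exp {d : ℕ} (hd : 1 ≤ d) {L : ℝ} (hL : 0 < L) (hl : 2 ≤ Real.log L)
    (hdL : (d : ℝ) ≤ √(L / (2 * Real.log L))) :
    (2 * d : ℝ) ^ (2 * d) ≤ Real.exp (3 / 4 * √(L * Real.log L)) := by
  have hd0 : (1 : ℝ) ≤ d := by exact_mod_cast hd
  have hsq : (d : ℝ) ^ 2 * (2 * Real.log L) ≤ L := by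
    rw [← le_div_iff₀ (by linarith)]
    exact (Real.le_sqrt (by positivity) (by positivity)).1 hdL
  have hlog : 2 * Real.log (2 * d) ≤ Real.log L := by
    rw [← Nat.cast_ofNat, ← Real.log_pow]
    refine Real.log_le_log (by positivity) ?_
    push_cast
    nlinarith
  have hs : d * Real.log L ≤ 3 / 4 * √(L * Real.log L) := by
    have h1 : 4 / 3 * (d * Real.log L) ≤ √(L * Real.log L) := by
      refine Real.le_sqrt_of_sq_le ?_
      have : (d : ℝ) ^ 2 * (2 * Real.log L) * Real.log L ≤ L * Real.log L := by gcongr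
      nlinarith
    linarith
  rw [← Real.exp_log (show (0 : ℝ) < (2 * d : ℝ) ^ (2 * d) by positivity), Real.log_pow]
  refine Real.exp_le_exp.2 (le_trans ?_ hs)
  push_cast
  nlinarith

end Asymptotics

theorem stmt19 (γ : ℝ) (hγ0 : 0 < γ) (hγ1 : γ < 1) :
    ∃ ε₀ : ℝ, 0 < ε₀ ∧ ∀ ε : ℝ, 0 < ε → ε < ε₀ →
    ∃ N₀ : ℕ, ∀ (G : Type) [Group G] [Fintype G] [DecidableEq G] (d : ℕ),
      N₀ ≤ Fintype.card G → 2 ≤ d → (d : ℝ) ≤ dN γ (Fintype.card G) →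
      -- condition (b): at most N^(1/d) elements with conjugacy class of size at most M
      ((Finset.univ.filter fun z : G => (cl z : ℝ) ≤ Mconst (Fintype.card G)).card : ℝ)
          ≤ (Fintype.card G : ℝ) ^ (1 / (d : ℝ)) →
      ∀ x : G, x * x ≠ 1 → Mconst (Fintype.card G) < (cl x : ℝ) →
      (1 - ε / 4) * (Fintype.card G : ℝ) ^ (d - 1) ≤
        ((Finset.univ.filter fun g : Fin (d - 1) → G =>
            Function.Injective g ∧ (∀ i, g i ≠ 1 ∧ g i ≠ x) ∧
            allProductsDistinct d x g).card : ℝ) := by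
  refine ⟨1, one_pos, fun ε hε _ => ?_⟩
  obtain ⟨N₀, hN₀⟩ := exists_forall_log_bounds (show 0 < ε / 4 by linarith)
  refine ⟨N₀, fun G _ _ _ d hN hd hdN hZ x hxx hx => ?_⟩
  obtain ⟨hl, hlL, hs1, hsε⟩ := hN₀ _ hN
  set N := Fintype.card G
  have hNpos : (0 : ℝ) < N := by exact_mod_cast Fintype.card_pos
  have hN1 : (1 : ℝ) ≤ N := by exact_mod_cast Fintype.card_pos
  unfold Mconst at hZ hx
  unfold dN at hdN
  set L := Real.log N with hL
  set s := √(L * Real.log L) with hs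
  have hLpos : 0 < L := by linarith
  have hsL : 4 * s ≤ L := by
    have : s ≤ L / 4 := Real.sqrt_le_iff.2 ⟨by linarith, by nlinarith⟩
    linarith
  have hpow : (2 * d : ℝ) ^ (2 * d) ≤ Real.exp (3 / 4 * s) := by
    refine two_mul_pow_le_exp (by omega) hLpos hl (hdN.trans ?_)
    exact mul_le_of_le_one_left (Real.sqrt_nonneg _) (by linarith)
  have hsmall : smallClassCard G (Real.exp (2 * s)) / N ≤ Real.exp (-(2 * s)) := by
    rw [div_le_iff₀ hNpos]
    calc smallClassCard G (Real.exp (2 * s)) ≤ (N : ℝ) ^ (1 / (d : ℝ)) := hZ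
      _ ≤ (N : ℝ) ^ (1 / 2 : ℝ) := by
        refine Real.rpow_le_rpow_of_exponent_le hN1 ?_
        gcongr
        exact_mod_cast hd
      _ = Real.exp (L * (1 / 2)) := Real.rpow_def_of_pos hNpos _
      _ ≤ Real.exp (-(2 * s) + L) := Real.exp_le_exp.2 (by linarith)
      _ = Real.exp (-(2 * s)) * N := by rw [Real.exp_add, hL, Real.exp_log hNpos]
  have hβ1 : 2 * Real.exp (-s) ≤ 1 := by
    have h2 : 2 ≤ Real.exp s := by linarith [Real.add_one_le_exp s]
    rw [Real.exp_neg, ← div_eq_mul_inv, div_le_one (Real.exp_pos s)]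
    exact h2
  have hsq : Real.exp (-(2 * s)) = Real.exp (-s) ^ 2 := by
    rw [← Real.exp_nat_mul]
    congr 1
    push_cast
    ring
  have hβM : smallClassCard G (Real.exp (2 * s)) / N + 1 / Real.exp (2 * s) ≤
      (2 * Real.exp (-s)) ^ 2 := by
    rw [one_div, ← Real.exp_neg]
    nlinarith [sq_nonneg (Real.exp (-s))]
  have hfinal : (2 * d : ℝ) ^ (2 * d) * (2 * Real.exp (-s)) ≤ ε / 4 := by
    refine le_trans ?_ hsε
    calc (2 * d : ℝ) ^ (2 * d) * (2 * Real.exp (-s))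
        ≤ Real.exp (3 / 4 * s) * (2 * Real.exp (-s)) := by gcongr
      _ = 2 * Real.exp (-(s / 4)) := by
        rw [mul_left_comm, ← Real.exp_add]
        ring_nf
  have hd1 : d - 1 < d := by omega
  calc (1 - ε / 4) * (N : ℝ) ^ (d - 1)
      ≤ (1 - (2 * d : ℝ) ^ (2 * d) * (2 * Real.exp (-s))) * (N : ℝ) ^ (d - 1) := by gcongr
    _ ≤ ((Finset.univ.filter fun g : Fin (d - 1) → G => allProductsDistinct d x g).card : ℝ) :=
      le_card_allProductsDistinct (Real.exp_pos _) (by positivity) hβ1 hβM hx hxx hd1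
    _ ≤ _ := by
      gcongr with g
      exact fun h => h.generic hd1
end
end
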